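/- arXiv:0810.3070 — 2 statements merged into one kernel-verified Lean document; each statement's English description precedes it below -/
import Mathlib

section
/- For α ∈ ℝ and σ > 0 let X^{(α,σ)}_t := σ ∫₀ᵗ ((T−t)/(T−s))^α dB_s, t ∈ [0,T), the unique strong solution of dX^{(α,σ)}_t = −(α/(T−t)) X^{(α,σ)}_t dt + σ dB_t, X^{(α,σ)}_0 = 0. For t ∈ (0,T) let P_{X^{(α,σ)},t} denote the law of (X^{(α,σ)}_s)_{s∈[0,t]} on (C[0,t], ℬ(C[0,t])). Then for all α₁, α₂ ∈ ℝ, σ₁ > 0, σ₂ > 0 and t ∈ (0,T) the following dichotomy holds: P_{X^{(α₁,σ₁)},t} and P_{X^{(α₂,σ₂)},t} are equivalent if σ₁ = σ₂, and are mutually singular if σ₁ ≠ σ₂. -/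
open MeasureTheory ProbabilityTheory Filter Set Topology
open scoped ENNReal NNReal

noncomputable section

variable {Ω : Type*} [MeasurableSpace Ω]

/-- `B` is a standard 1-dimensional Wiener process on the probability space `(Ω, 𝒜, P)`:
it starts at `0`, has a.s. continuous paths, and its increments are independent of the past
and Gaussian with the correct variance. -/
structure IsStandardWiener (P : Measure Ω) (B : ℝ → Ω → ℝ) : Prop where
  meas : ∀ t : ℝ, Measurable (B t)
  init : ∀ᵐ ω ∂P, B 0 ω = 0
  cont : ∀ᵐ ω ∂P, Continuous fun t => B t ω
  incr_indep : ∀ s t : ℝ, 0 ≤ s → s ≤ t →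
    IndepFun (fun ω => B t ω - B s ω) (fun ω (u : Set.Icc (0:ℝ) s) => B u.1 ω) P
  incr_law : ∀ s t : ℝ, 0 ≤ s → s ≤ t →
    Measure.map (fun ω => B t ω - B s ω) P = gaussianReal 0 (Real.toNNReal (t - s))

/-- The `α`-Wiener bridge `X^{(α)}_t = ∫₀ᵗ ((T−t)/(T−s))^α dB_s`, `t ∈ [0,T)`, realized
pathwise through the integration-by-parts representation of the Wiener integral:
`X^{(α)}_t = B_t − α (T−t)^α ∫₀ᵗ (T−s)^{−α−1} B_s ds`. -/
def alphaWienerBridge (T α : ℝ) (B : ℝ → Ω → ℝ) (t : ℝ) (ω : Ω) : ℝ :=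
  B t ω - α * (T - t) ^ α * ∫ s in Set.Ioc (0:ℝ) t, (T - s) ^ (-α - 1) * B s ω

open scoped Classical

/-- The supremum distance `sup_{s∈[0,t]} |x(s) − y(s)|` on `C[0,t]`. -/
def supDist (t : ℝ) (x y : ℝ → ℝ) : ℝ := sSup ((fun s => |x s - y s|) '' Set.Icc (0:ℝ) t)

/-- The space `C[0,t]` of continuous real-valued functions on `[0,t]`. -/
def ContPathIcc (t : ℝ) : Type := {x : ℝ → ℝ // ContinuousOn x (Set.Icc 0 t)}

/-- The Borel σ-algebra of the separable metric space `C[0,t]`, generated by the open balls of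
the supremum metric. -/
def borelSup (t : ℝ) : MeasurableSpace (ContPathIcc t) :=
  MeasurableSpace.generateFrom
    {S : Set (ContPathIcc t) | ∃ (x : ContPathIcc t) (r : ℝ),
      S = {y : ContPathIcc t | supDist t x.1 y.1 < r}}

/-- The path map `ω ↦ (X^{(α,σ)}_s(ω))_{s∈[0,t]} ∈ C[0,t]` for the process
`X^{(α,σ)} = σ ∫₀^· ((T−·)/(T−s))^α dB_s` (with an irrelevant default on the null set where the
path fails to be continuous). -/
def sigmaBridgePath (T α σv t : ℝ) (B : ℝ → Ω → ℝ) (ω : Ω) : ContPathIcc t :=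
  if h : ContinuousOn (fun s => σv * alphaWienerBridge T α B s ω) (Set.Icc 0 t)
  then ⟨fun s => σv * alphaWienerBridge T α B s ω, h⟩
  else ⟨fun _ => 0, continuousOn_const⟩

/-- Translating a centred Gaussian variable amounts to an exponential change of density. -/
lemma lintegral_gaussianReal_sub {v : ℝ≥0} (hv : v ≠ 0) (c : ℝ) (f : ℝ → ℝ≥0∞) :
    ∫⁻ y, f (y - c) ∂gaussianReal 0 v =
      ∫⁻ y, f y * ENNReal.ofReal (Real.exp (-(c * y) / v - c ^ 2 / (2 * v)))
        ∂gaussianReal 0 v := by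
  have hv' : (v : ℝ) ≠ 0 := by exact_mod_cast hv
  have hfin : ∀ᵐ x ∂(volume : Measure ℝ), gaussianPDF 0 v x < ∞ :=
    ae_of_all _ fun x => ENNReal.ofReal_lt_top
  rw [gaussianReal_of_var_ne_zero 0 hv,
    lintegral_withDensity_eq_lintegral_mul_non_measurable _ (measurable_gaussianPDF 0 v) hfin,
    lintegral_withDensity_eq_lintegral_mul_non_measurable _ (measurable_gaussianPDF 0 v) hfin,
    ← lintegral_add_right_eq_self _ c]
  refine lintegral_congr fun x => ?_
  simp only [Pi.mul_apply, add_sub_cancel_right, gaussianPDF]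
  have h : gaussianPDFReal 0 v (x + c) =
      gaussianPDFReal 0 v x * Real.exp (-(c * x) / v - c ^ 2 / (2 * v)) := by
    simp only [gaussianPDFReal, sub_zero, mul_assoc, ← Real.exp_add]
    congr 2
    field_simp
    ring
  rw [h, ENNReal.ofReal_mul (gaussianPDFReal_nonneg 0 v x)]
  ring

/-- The law of a function of two independent variables is computed by Fubini's theorem. -/
lemma IndepFun.lintegral_comp_prodMk {β γ : Type*} [MeasurableSpace β] [MeasurableSpace γ]
    {P : Measure Ω} [IsFiniteMeasure P] {X : Ω → β} {Y : Ω → γ} (hX : Measurable X)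
    (hY : Measurable Y) (h : IndepFun X Y P) {G : γ × β → ℝ≥0∞} (hG : Measurable G) :
    ∫⁻ ω, G (Y ω, X ω) ∂P = ∫⁻ ω, ∫⁻ x, G (Y ω, x) ∂(P.map X) ∂P := by
  have hmap := (indepFun_iff_map_prod_eq_prod_map_map hY.aemeasurable hX.aemeasurable).1 h.symm
  have hfin : IsFiniteMeasure (P.map X) := Measure.isFiniteMeasure_map P X
  rw [← lintegral_map (f := G) hG (hY.prodMk hX), hmap, lintegral_prod _ hG.aemeasurable,
    lintegral_map hG.lintegral_prod_right' hY]

/-- A quantitative comparison of integrals of continuous functions implies absolute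
continuity. -/
lemma absolutelyContinuous_of_lintegral_le {E : Type*} [TopologicalSpace E]
    [TopologicalSpace.PseudoMetrizableSpace E] [MeasurableSpace E] [BorelSpace E]
    {μ ν : Measure E} [IsFiniteMeasure μ] [IsFiniteMeasure ν]
    (h : ∀ ε : ℝ≥0∞, 0 < ε → ∃ M : ℝ≥0∞, M ≠ ∞ ∧ ∀ F : BoundedContinuousFunction E ℝ≥0,
      (∀ x, F x ≤ 1) → ∫⁻ x, F x ∂ν ≤ M * ∫⁻ x, F x ∂μ + ε) :
    ν ≪ μ := by
  refine Measure.AbsolutelyContinuous.mk fun A hA hμA => ?_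
  rw [hA.measure_eq_iSup_isClosed_of_ne_top (measure_ne_top ν A)]
  simp only [ENNReal.iSup_eq_zero]
  intro K hKA hK
  have hμK : μ K = 0 := measure_mono_null hKA hμA
  refine nonpos_iff_eq_zero.1 (le_of_forall_pos_le_add fun ε hε => ?_)
  obtain ⟨M, hM, hF⟩ := h ε hε
  have h1 := HasOuterApproxClosed.tendsto_lintegral_apprSeq hK ν
  have h2 := HasOuterApproxClosed.tendsto_lintegral_apprSeq hK μ
  have h3 := (ENNReal.Tendsto.const_mul h2 (Or.inr hM)).add_const ε
  have h4 := le_of_tendsto_of_tendsto' h1 h3 fun n =>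
    hF (hK.apprSeq n) (HasOuterApproxClosed.apprSeq_apply_le_one hK n)
  simpa [hμK] using h4

/-- The Euler scheme with step `h` for `dS = -a S dt + db`, started at `0`. -/
def eulerState (h : ℝ) (a b : ℕ → ℝ) : ℕ → ℝ
  | 0 => 0
  | k + 1 => eulerState h a b k - h * a k * eulerState h a b k + b k

/-- The sequence `x` set to zero after time `k`. -/
def truncSeq (k : ℕ) (x : ℕ → ℝ) : ℕ → ℝ := fun j => if j ≤ k then x j else 0

/-- The log-likelihood, along the states `x 0, …, x k`, of the Euler scheme with drift `a` with
respect to the one without drift. -/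
def eulerLogLik (h : ℝ) (a : ℕ → ℝ) (k : ℕ) (x : ℕ → ℝ) : ℝ :=
  ∑ j ∈ Finset.range k, (-(a j * x j * (x (j + 1) - x j)) - a j ^ 2 * x j ^ 2 * h / 2)

/-- The first `k` terms of `b`, followed by zeros. -/
def pastSeq (k : ℕ) (b : ℕ → ℝ) : ℕ → ℝ := fun j => if j < k then b j else 0

lemma measurable_eulerState (h : ℝ) (a : ℕ → ℝ) (k : ℕ) :
    Measurable fun b => eulerState h a b k := by
  induction k with
  | zero => exact measurable_const
  | succ k ih => exact (ih.sub (ih.const_mul _)).add (measurable_pi_apply k)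

lemma measurable_truncSeq (k : ℕ) : Measurable (truncSeq k) := by
  refine measurable_pi_lambda _ fun j => ?_
  by_cases hj : j ≤ k
  · simpa [truncSeq, hj] using measurable_pi_apply j
  · simp [truncSeq, hj]

lemma measurable_eulerLogLik (h : ℝ) (a : ℕ → ℝ) (k : ℕ) : Measurable (eulerLogLik h a k) := by
  unfold eulerLogLik
  fun_prop

lemma eulerState_pastSeq (h : ℝ) (a b : ℕ → ℝ) {j k : ℕ} (hjk : j ≤ k) :
    eulerState h a (pastSeq k b) j = eulerState h a b j := by
  induction j with
  | zero => rfl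
  | succ j ih => simp [eulerState, ih (by omega), pastSeq, show j < k by omega]

lemma truncSeq_succ (k : ℕ) (x : ℕ → ℝ) :
    truncSeq (k + 1) x = Function.update (truncSeq k x) (k + 1) (x (k + 1)) := by
  funext j
  rcases eq_or_ne j (k + 1) with rfl | hj
  · simp [truncSeq]
  · have : j ≤ k + 1 ↔ j ≤ k := by omega
    simp [truncSeq, hj, this]

lemma eulerLogLik_truncSeq (h : ℝ) (a : ℕ → ℝ) (k : ℕ) (x : ℕ → ℝ) :
    eulerLogLik h a k (truncSeq k x) = eulerLogLik h a k x := by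
  refine Finset.sum_congr rfl fun j hj => ?_
  have hj' := Finset.mem_range.1 hj
  simp [truncSeq, hj'.le, Nat.succ_le_of_lt hj']

/-- Girsanov's formula for the Euler scheme driven by independent Gaussian increments. -/
lemma lintegral_eulerState {P : Measure Ω} [IsProbabilityMeasure P] {h : ℝ≥0} (hh : h ≠ 0)
    (a : ℕ → ℝ) {b : Ω → ℕ → ℝ} (hb : Measurable b)
    (hind : ∀ k, IndepFun (fun ω => b ω k) (fun ω => pastSeq k (b ω)) P)
    (hlaw : ∀ k, P.map (fun ω => b ω k) = gaussianReal 0 h) (k : ℕ)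
    {G : (ℕ → ℝ) → ℝ≥0∞} (hG : Measurable G) :
    ∫⁻ ω, G (truncSeq k (eulerState h a (b ω))) ∂P =
      ∫⁻ ω, G (truncSeq k (eulerState h 0 (b ω))) *
        ENNReal.ofReal (Real.exp (eulerLogLik h a k (eulerState h 0 (b ω)))) ∂P := by
  have hh' : (h : ℝ) ≠ 0 := by exact_mod_cast hh
  have hstate (a : ℕ → ℝ) : Measurable (eulerState h a) :=
    measurable_pi_lambda _ (measurable_eulerState h a)
  have hpast (a : ℕ → ℝ) (k : ℕ) :
      IndepFun (fun ω => b ω k) (fun ω => truncSeq k (eulerState h a (b ω))) P := by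
    have := (hind k).comp measurable_id ((measurable_truncSeq k).comp (hstate a))
    refine this.congr (ae_of_all _ fun ω => rfl) (ae_of_all _ fun ω => ?_)
    funext j
    by_cases hj : j ≤ k
    · simp [truncSeq, hj, eulerState_pastSeq h a (b ω) hj]
    · simp [truncSeq, hj]
  have hbk (k : ℕ) : Measurable fun ω => b ω k := (measurable_pi_apply k).comp hb
  have htr (a : ℕ → ℝ) (k : ℕ) : Measurable fun ω => truncSeq k (eulerState h a (b ω)) :=
    (measurable_truncSeq k).comp ((hstate a).comp hb)
  induction k generalizing G with
  | zero =>
    refine lintegral_congr fun ω => ?_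
    have : truncSeq 0 (eulerState h a (b ω)) = truncSeq 0 (eulerState h 0 (b ω)) := by
      funext j
      by_cases hj : j = 0
      · subst hj; simp [truncSeq, eulerState]
      · simp [truncSeq, hj]
    simp [this, eulerLogLik]
  | succ k ih =>
    have hupd : Measurable fun p : (ℕ → ℝ) × ℝ =>
        Function.update p.1 (k + 1) (p.1 k + p.2) := by
      refine measurable_pi_lambda _ fun j => ?_
      by_cases hj : j = k + 1
      · subst hj; simp only [Function.update_self]; fun_prop
      · simp only [Function.update_of_ne hj]; fun_prop
    set w : (ℕ → ℝ) × ℝ → ℝ≥0∞ := fun p =>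
      ENNReal.ofReal (Real.exp (-(h * a k * p.1 k * p.2) / h - (h * a k * p.1 k) ^ 2 / (2 * h)))
      with hw
    have hwm : Measurable w := by fun_prop
    have hGu : Measurable fun p : (ℕ → ℝ) × ℝ =>
        G (Function.update p.1 (k + 1) (p.1 k + p.2)) := hG.comp hupd
    have hG' : Measurable fun x : ℕ → ℝ =>
        ∫⁻ y, G (Function.update x (k + 1) (x k + y)) * w (x, y) ∂gaussianReal 0 h :=
      (hGu.mul hwm).lintegral_prod_right'
    calc ∫⁻ ω, G (truncSeq (k + 1) (eulerState h a (b ω))) ∂P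
        = ∫⁻ ω, (fun p : (ℕ → ℝ) × ℝ => G (Function.update p.1 (k + 1)
            (p.1 k + (p.2 - h * a k * p.1 k))))
            (truncSeq k (eulerState h a (b ω)), b ω k) ∂P := by
          refine lintegral_congr fun ω => ?_
          simp only [truncSeq_succ]
          congr 2
          simp only [truncSeq, le_refl, if_true, eulerState]
          ring
      _ = ∫⁻ ω, ∫⁻ y, G (Function.update (truncSeq k (eulerState h a (b ω))) (k + 1)
            (truncSeq k (eulerState h a (b ω)) k +
              (y - h * a k * truncSeq k (eulerState h a (b ω)) k))) ∂gaussianReal 0 h ∂P := by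
          rw [← hlaw k]
          refine IndepFun.lintegral_comp_prodMk (G := fun p : (ℕ → ℝ) × ℝ =>
            G (Function.update p.1 (k + 1) (p.1 k + (p.2 - h * a k * p.1 k))))
            (hbk k) (htr a k) (hpast a k) ?_
          exact hGu.comp (f := fun p : (ℕ → ℝ) × ℝ => (p.1, p.2 - h * a k * p.1 k)) (by fun_prop)
      _ = ∫⁻ ω, (fun x : ℕ → ℝ =>
            ∫⁻ y, G (Function.update x (k + 1) (x k + y)) * w (x, y) ∂gaussianReal 0 h)
            (truncSeq k (eulerState h a (b ω))) ∂P := by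
          refine lintegral_congr fun ω => ?_
          set x := truncSeq k (eulerState h a (b ω))
          exact lintegral_gaussianReal_sub hh (h * a k * x k)
            fun y => G (Function.update x (k + 1) (x k + y))
      _ = ∫⁻ ω, ∫⁻ y, (fun p : (ℕ → ℝ) × ℝ => G (Function.update p.1 (k + 1) (p.1 k + p.2)) *
            w p * ENNReal.ofReal (Real.exp (eulerLogLik h a k p.1)))
            (truncSeq k (eulerState h 0 (b ω)), y) ∂gaussianReal 0 h ∂P := by
          rw [ih hG']
          refine lintegral_congr fun ω => ?_
          dsimp only
          rw [eulerLogLik_truncSeq, lintegral_mul_const]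
          exact (hGu.mul hwm).comp measurable_prodMk_left
      _ = _ := by
          have hL := measurable_eulerLogLik h a k
          rw [← hlaw k]
          refine (IndepFun.lintegral_comp_prodMk (G := fun p : (ℕ → ℝ) × ℝ =>
            G (Function.update p.1 (k + 1) (p.1 k + p.2)) * w p *
              ENNReal.ofReal (Real.exp (eulerLogLik h a k p.1)))
            (hbk k) (htr 0 k) (hpast 0 k) (by fun_prop)).symm.trans ?_
          refine lintegral_congr fun ω => ?_
          simp only [truncSeq_succ, eulerLogLik_truncSeq, mul_assoc, hw]
          rw [← ENNReal.ofReal_mul (Real.exp_pos _).le, ← Real.exp_add]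
          congr 3
          · simp [truncSeq, eulerState]
          · simp only [eulerLogLik, Finset.sum_range_succ]
            simp only [truncSeq, le_refl, if_true, eulerState, Pi.zero_apply]
            field_simp
            ring_nf

/-- Second moment of a random affine function of an independent centred Gaussian variable. -/
lemma integral_add_mul_gaussian_sq {P : Measure Ω} [IsProbabilityMeasure P] {h : ℝ≥0}
    {U V N : Ω → ℝ} (hU : MemLp U 2 P) (hV : MemLp V 2 P) (hN : Measurable N)
    (hind : IndepFun N (fun ω => (U ω, V ω)) P) (hlaw : P.map N = gaussianReal 0 h) :
    MemLp (fun ω => U ω + V ω * N ω) 2 P ∧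
      ∫ ω, (U ω + V ω * N ω) ^ 2 ∂P = ∫ ω, U ω ^ 2 ∂P + h * ∫ ω, V ω ^ 2 ∂P := by
  have hNL : MemLp N 2 P := by
    have := memLp_id_gaussianReal' (μ := 0) (v := h) 2 (by simp)
    rw [← hlaw] at this
    exact (memLp_map_measure_iff aestronglyMeasurable_id hN.aemeasurable).1 this
  have hN1 : ∫ ω, N ω ∂P = 0 := by
    have := integral_id_gaussianReal (μ := 0) (v := h)
    rwa [← hlaw, integral_map hN.aemeasurable (by fun_prop)] at this
  have hN2 : ∫ ω, N ω ^ 2 ∂P = h := by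
    have hvar := variance_id_gaussianReal (μ := 0) (v := h)
    rw [variance_of_integral_eq_zero aemeasurable_id (by simp [integral_id_gaussianReal]),
      ← hlaw, integral_map hN.aemeasurable (by fun_prop)] at hvar
    simpa using hvar
  have hiUV : Integrable (fun ω => U ω * V ω) P := hU.integrable_mul hV
  have hi1 : IndepFun (fun ω => U ω * V ω) N P :=
    (hind.comp measurable_id (φ := id) (ψ := fun p : ℝ × ℝ => p.1 * p.2) (by fun_prop)).symm
  have hi2 : IndepFun (fun ω => V ω ^ 2) (fun ω => N ω ^ 2) P :=
    (hind.comp (φ := fun x => x ^ 2) (ψ := fun p : ℝ × ℝ => p.2 ^ 2)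
      (by fun_prop) (by fun_prop)).symm
  have hNi : Integrable N P := hNL.integrable (by norm_num)
  have I1 : Integrable (fun ω => U ω * V ω * N ω) P := hi1.integrable_mul hiUV hNi
  have I2 : Integrable (fun ω => V ω ^ 2 * N ω ^ 2) P :=
    hi2.integrable_mul hV.integrable_sq hNL.integrable_sq
  have E1 : ∫ ω, U ω * V ω * N ω ∂P = 0 := by
    have := hi1.integral_mul_eq_mul_integral hiUV.1 hNi.1
    simpa [hN1] using this
  have E2 : ∫ ω, V ω ^ 2 * N ω ^ 2 ∂P = h * ∫ ω, V ω ^ 2 ∂P := by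
    have := hi2.integral_mul_eq_mul_integral hV.integrable_sq.1 hNL.integrable_sq.1
    rw [hN2] at this
    exact this.trans (mul_comm _ _)
  have hexp : (fun ω => (U ω + V ω * N ω) ^ 2) =
      fun ω => U ω ^ 2 + 2 * (U ω * V ω * N ω) + V ω ^ 2 * N ω ^ 2 := by
    funext ω; ring
  have hUi := hU.integrable_sq
  have I12 : Integrable (fun ω => U ω ^ 2 + 2 * (U ω * V ω * N ω)) P := hUi.add (I1.const_mul 2)
  refine ⟨(memLp_two_iff_integrable_sq
    (hU.1.add (hV.1.mul hN.aestronglyMeasurable))).2 ?_, ?_⟩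
  · change Integrable (fun ω => (U ω + V ω * N ω) ^ 2) P
    rw [hexp]
    exact I12.add I2
  · rw [hexp, integral_add I12 I2, integral_add hUi (I1.const_mul 2), integral_const_mul, E1, E2]
    ring

/-- The stochastic integral of `a S` along the Euler scheme `S` with drift `c`. -/
def eulerSum (h : ℝ) (a c : ℕ → ℝ) (k : ℕ) (b : ℕ → ℝ) : ℝ :=
  ∑ j ∈ Finset.range k, a j * eulerState h c b j * b j

lemma measurable_eulerSum (h : ℝ) (a c : ℕ → ℝ) (k : ℕ) : Measurable (eulerSum h a c k) :=
  Finset.measurable_sum _ fun j _ =>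
    ((measurable_eulerState h c j).const_mul (a j)).mul (measurable_pi_apply j)

lemma eulerSum_pastSeq (h : ℝ) (a c b : ℕ → ℝ) (k : ℕ) :
    eulerSum h a c k (pastSeq k b) = eulerSum h a c k b := by
  refine Finset.sum_congr rfl fun j hj => ?_
  have hj' := Finset.mem_range.1 hj
  rw [eulerState_pastSeq h c b hj'.le]
  simp [pastSeq, hj']

lemma eulerLogLik_eulerState (h : ℝ) (a c b : ℕ → ℝ) (k : ℕ) :
    eulerLogLik h a k (eulerState h c b) = -eulerSum h a c k b +
      ∑ j ∈ Finset.range k, h * (a j * c j - a j ^ 2 / 2) * eulerState h c b j ^ 2 := by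
  simp only [eulerLogLik, eulerSum, ← Finset.sum_neg_distrib, ← Finset.sum_add_distrib]
  refine Finset.sum_congr rfl fun j _ => ?_
  simp only [eulerState]
  ring

section Moments

variable {P : Measure Ω} [IsProbabilityMeasure P] {h : ℝ≥0} {b : Ω → ℕ → ℝ}

lemma eulerState_moment (c : ℕ → ℝ) {A : ℝ} (hc : ∀ k, |c k| ≤ A) (hb : Measurable b)
    (hind : ∀ k, IndepFun (fun ω => b ω k) (fun ω => pastSeq k (b ω)) P)
    (hlaw : ∀ k, P.map (fun ω => b ω k) = gaussianReal 0 h) (k : ℕ) :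
    MemLp (fun ω => eulerState h c (b ω) k) 2 P ∧
      ∫ ω, eulerState h c (b ω) k ^ 2 ∂P ≤ k * h * ((1 + h * A) ^ 2) ^ k := by
  have hA : 0 ≤ A := (abs_nonneg _).trans (hc 0)
  induction k with
  | zero => simp [eulerState]
  | succ k ih =>
    have hU : MemLp (fun ω => (1 - h * c k) * eulerState h c (b ω) k) 2 P := ih.1.const_mul _
    have hi : IndepFun (fun ω => b ω k)
        (fun ω => ((1 - h * c k) * eulerState h c (b ω) k, (1 : ℝ))) P := by
      have hm := measurable_eulerState h c k
      have := (hind k).comp measurable_id (ψ := fun x =>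
        ((1 - h * c k) * eulerState h c x k, (1 : ℝ))) (by fun_prop)
      simpa [Function.comp_def, eulerState_pastSeq] using this
    obtain ⟨h1, h2⟩ := integral_add_mul_gaussian_sq hU (memLp_const 1)
      (N := fun ω => b ω k) ((measurable_pi_apply k).comp hb) hi (hlaw k)
    have hS (ω : Ω) : eulerState h c (b ω) (k + 1) =
        (1 - h * c k) * eulerState h c (b ω) k + 1 * b ω k := by
      simp only [eulerState]; ring
    simp only [hS]
    refine ⟨h1, ?_⟩
    rw [h2]
    simp only [mul_pow, integral_const_mul]
    have h3 : (1 - h * c k) ^ 2 ≤ (1 + h * A) ^ 2 := by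
      have := abs_le.1 (hc k)
      have hh := h.coe_nonneg
      apply sq_le_sq'
      · nlinarith
      · nlinarith
    have h4 : (1 : ℝ) ≤ (1 + h * A) ^ 2 := by
      have : 0 ≤ h * A := by positivity
      nlinarith
    have h5 : (1 : ℝ) ≤ ((1 + h * A) ^ 2) ^ (k + 1) := one_le_pow₀ h4
    have h6 : 0 ≤ ∫ ω, eulerState h c (b ω) k ^ 2 ∂P := integral_nonneg fun ω => sq_nonneg _
    calc (1 - h * c k) ^ 2 * ∫ ω, eulerState h c (b ω) k ^ 2 ∂P + h * ∫ _, (1 : ℝ) ^ 2 ∂P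
        ≤ (1 + h * A) ^ 2 * (k * h * ((1 + h * A) ^ 2) ^ k)
            + h * ((1 + h * A) ^ 2) ^ (k + 1) := by
          gcongr
          · exact ih.2
          · simpa using h5
      _ = ((k + 1 : ℕ) : ℝ) * h * ((1 + h * A) ^ 2) ^ (k + 1) := by push_cast; ring

lemma eulerSum_moment (a c : ℕ → ℝ) {A : ℝ} (hc : ∀ k, |c k| ≤ A)
    (hb : Measurable b)
    (hind : ∀ k, IndepFun (fun ω => b ω k) (fun ω => pastSeq k (b ω)) P)
    (hlaw : ∀ k, P.map (fun ω => b ω k) = gaussianReal 0 h) (k : ℕ) :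
    MemLp (fun ω => eulerSum h a c k (b ω)) 2 P ∧
      ∫ ω, eulerSum h a c k (b ω) ^ 2 ∂P =
        ∑ j ∈ Finset.range k, h * (a j ^ 2 * ∫ ω, eulerState h c (b ω) j ^ 2 ∂P) := by
  induction k with
  | zero => simp [eulerSum]
  | succ k ih =>
    have hS := (eulerState_moment c hc hb hind hlaw k).1
    have hi : IndepFun (fun ω => b ω k)
        (fun ω => (eulerSum h a c k (b ω), a k * eulerState h c (b ω) k)) P := by
      have hm := measurable_eulerState h c k
      have hm' := measurable_eulerSum h a c k
      have := (hind k).comp measurable_id (ψ := fun x =>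
        (eulerSum h a c k x, a k * eulerState h c x k)) (by fun_prop)
      simpa [Function.comp_def, eulerState_pastSeq, eulerSum_pastSeq] using this
    obtain ⟨h1, h2⟩ := integral_add_mul_gaussian_sq ih.1 (hS.const_mul (a k))
      (N := fun ω => b ω k) ((measurable_pi_apply k).comp hb) hi (hlaw k)
    have hM (ω : Ω) : eulerSum h a c (k + 1) (b ω) =
        eulerSum h a c k (b ω) + a k * eulerState h c (b ω) k * b ω k := by
      simp only [eulerSum, Finset.sum_range_succ]
    simp only [hM, Finset.sum_range_succ]
    refine ⟨h1, ?_⟩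
    rw [h2, ih.2]
    simp only [mul_pow, integral_const_mul]

/-- The log-likelihood is bounded in `L¹`, uniformly in the mesh of the Euler scheme. -/
lemma eulerLogLik_moment (a c : ℕ → ℝ) {A t : ℝ} (ha : ∀ k, |a k| ≤ A) (hc : ∀ k, |c k| ≤ A)
    (hb : Measurable b)
    (hind : ∀ k, IndepFun (fun ω => b ω k) (fun ω => pastSeq k (b ω)) P)
    (hlaw : ∀ k, P.map (fun ω => b ω k) = gaussianReal 0 h) {n : ℕ} (hn : n * h = t) :
    Integrable (fun ω => eulerLogLik h a n (eulerState h c (b ω))) P ∧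
      ∫ ω, |eulerLogLik h a n (eulerState h c (b ω))| ∂P ≤
        1 + 3 * A ^ 2 * t ^ 2 * Real.exp (2 * A * t) := by
  have hA : 0 ≤ A := (abs_nonneg _).trans (hc 0)
  have hh := h.coe_nonneg
  have ht : 0 ≤ t := by rw [← hn]; positivity
  obtain ⟨hM, hM2⟩ := eulerSum_moment a c hc hb hind hlaw n
  have hSj (j : ℕ) (hj : j ∈ Finset.range n) :
      ∫ ω, eulerState h c (b ω) j ^ 2 ∂P ≤ t * Real.exp (2 * A * t) := by
    refine (eulerState_moment c hc hb hind hlaw j).2.trans ?_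
    have hj' : (j : ℝ) ≤ n := by exact_mod_cast (Finset.mem_range.1 hj).le
    have h1 : (1 + h * A) ^ 2 ≤ Real.exp (2 * (h * A)) := by
      rw [two_mul, Real.exp_add, ← sq]
      have := Real.add_one_le_exp (h * A)
      gcongr
      linarith
    calc (j : ℝ) * h * ((1 + h * A) ^ 2) ^ j ≤ n * h * Real.exp (2 * (h * A)) ^ j := by gcongr
      _ = t * Real.exp (j * (2 * (h * A))) := by rw [hn, Real.exp_nat_mul]
      _ ≤ t * Real.exp (2 * A * t) := by
        refine mul_le_mul_of_nonneg_left (Real.exp_le_exp.2 ?_) ht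
        rw [← hn]
        nlinarith [mul_le_mul_of_nonneg_right hj' (show 0 ≤ 2 * (h * A) by positivity)]
  have ha2 (j : ℕ) : a j ^ 2 ≤ A ^ 2 := sq_le_sq.2 ((ha j).trans (le_abs_self A))
  have hcoef (j : ℕ) : |a j * c j - a j ^ 2 / 2| ≤ 3 / 2 * A ^ 2 := by
    have h1 : |a j * c j| ≤ A * A := by
      rw [abs_mul]; exact mul_le_mul (ha j) (hc j) (abs_nonneg _) hA
    have h2 := abs_le.1 h1
    have h3 := ha2 j
    have h4 := sq_nonneg (a j)
    exact abs_le.2 ⟨by nlinarith, by nlinarith⟩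
  set Q : Ω → ℝ := fun ω =>
    ∑ j ∈ Finset.range n, h * (3 / 2 * A ^ 2) * eulerState h c (b ω) j ^ 2 with hQ
  have hSi (j : ℕ) : Integrable (fun ω => eulerState h c (b ω) j ^ 2) P :=
    (eulerState_moment c hc hb hind hlaw j).1.integrable_sq
  have hQi : Integrable Q P := integrable_finsetSum _ fun j _ => (hSi j).const_mul _
  have hQE : ∫ ω, Q ω ∂P ≤ 3 / 2 * A ^ 2 * t ^ 2 * Real.exp (2 * A * t) := by
    rw [hQ, integral_finsetSum _ fun j _ => (hSi j).const_mul _]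
    calc ∑ j ∈ Finset.range n, ∫ ω, h * (3 / 2 * A ^ 2) * eulerState h c (b ω) j ^ 2 ∂P
        ≤ ∑ j ∈ Finset.range n, h * (3 / 2 * A ^ 2) * (t * Real.exp (2 * A * t)) := by
          refine Finset.sum_le_sum fun j hj => ?_
          rw [integral_const_mul]
          exact mul_le_mul_of_nonneg_left (hSj j hj) (by positivity)
      _ = (n * h) * (3 / 2 * A ^ 2) * (t * Real.exp (2 * A * t)) := by
          rw [Finset.sum_const, Finset.card_range, nsmul_eq_mul]; ring
      _ = _ := by rw [hn]; ring
  have hME : ∫ ω, eulerSum h a c n (b ω) ^ 2 ∂P ≤ A ^ 2 * t ^ 2 * Real.exp (2 * A * t) := by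
    rw [hM2]
    calc ∑ j ∈ Finset.range n, h * (a j ^ 2 * ∫ ω, eulerState h c (b ω) j ^ 2 ∂P)
        ≤ ∑ j ∈ Finset.range n, h * (A ^ 2 * (t * Real.exp (2 * A * t))) := by
          refine Finset.sum_le_sum fun j hj => ?_
          refine mul_le_mul_of_nonneg_left (mul_le_mul (ha2 j) (hSj j hj) ?_ (sq_nonneg A)) hh
          exact integral_nonneg fun ω => sq_nonneg _
      _ = (n * h) * A ^ 2 * (t * Real.exp (2 * A * t)) := by
          rw [Finset.sum_const, Finset.card_range, nsmul_eq_mul]; ring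
      _ = _ := by rw [hn]; ring
  have hbd (ω : Ω) : |eulerLogLik h a n (eulerState h c (b ω))| ≤
      1 + eulerSum h a c n (b ω) ^ 2 + Q ω := by
    rw [eulerLogLik_eulerState]
    refine (abs_add_le _ _).trans (add_le_add ?_ ?_)
    · rw [abs_neg]
      nlinarith [sq_abs (eulerSum h a c n (b ω)), sq_nonneg (|eulerSum h a c n (b ω)| - 1)]
    · refine (Finset.abs_sum_le_sum_abs _ _).trans (Finset.sum_le_sum fun j _ => ?_)
      rw [abs_mul, abs_mul, abs_of_nonneg hh, abs_of_nonneg (sq_nonneg (eulerState h c (b ω) j))]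
      have := hcoef j
      gcongr
  have hbi : Integrable (fun ω => 1 + eulerSum h a c n (b ω) ^ 2 + Q ω) P :=
    ((integrable_const 1).add hM.integrable_sq).add hQi
  have hmeas : Measurable fun ω => eulerLogLik h a n (eulerState h c (b ω)) :=
    (measurable_eulerLogLik h a n).comp
      ((measurable_pi_lambda _ (measurable_eulerState h c)).comp hb)
  have hi := hbi.mono' hmeas.aestronglyMeasurable (ae_of_all _ hbd)
  refine ⟨hi, (integral_mono hi.abs hbi hbd).trans ?_⟩
  have hsplit : ∫ ω, (1 + eulerSum h a c n (b ω) ^ 2 + Q ω) ∂P =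
      1 + ∫ ω, eulerSum h a c n (b ω) ^ 2 ∂P + ∫ ω, Q ω ∂P := by
    rw [integral_add (f := fun ω => 1 + eulerSum h a c n (b ω) ^ 2)
      ((integrable_const 1).add hM.integrable_sq) hQi,
      integral_add (integrable_const 1) hM.integrable_sq]
    simp
  rw [hsplit]
  have : 0 ≤ A ^ 2 * t ^ 2 * Real.exp (2 * A * t) := by positivity
  linarith

end Moments

/-- The laws of the Euler schemes with and without drift dominate each other, up to a small
error, uniformly in the mesh. -/
lemma lintegral_eulerState_le {P : Measure Ω} [IsProbabilityMeasure P] {h : ℝ≥0} (hh : h ≠ 0)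
    {b : Ω → ℕ → ℝ} (a : ℕ → ℝ) {A t : ℝ} (ha : ∀ k, |a k| ≤ A) (hb : Measurable b)
    (hind : ∀ k, IndepFun (fun ω => b ω k) (fun ω => pastSeq k (b ω)) P)
    (hlaw : ∀ k, P.map (fun ω => b ω k) = gaussianReal 0 h) {n : ℕ} (hn : n * h = t)
    {G : (ℕ → ℝ) → ℝ≥0∞} (hG : Measurable G) (hG1 : ∀ x, G x ≤ 1) {K : ℝ} (hK : 0 < K) :
    ∫⁻ ω, G (truncSeq n (eulerState h 0 (b ω))) ∂P ≤
        ENNReal.ofReal (Real.exp K) * ∫⁻ ω, G (truncSeq n (eulerState h a (b ω))) ∂P +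
          ENNReal.ofReal ((1 + 3 * A ^ 2 * t ^ 2 * Real.exp (2 * A * t)) / K) ∧
      ∫⁻ ω, G (truncSeq n (eulerState h a (b ω))) ∂P ≤
        ENNReal.ofReal (Real.exp K) * ∫⁻ ω, G (truncSeq n (eulerState h 0 (b ω))) ∂P +
          ENNReal.ofReal ((1 + 3 * A ^ 2 * t ^ 2 * Real.exp (2 * A * t)) / K) := by
  have hA : 0 ≤ A := (abs_nonneg _).trans (ha 0)
  have hS (c : ℕ → ℝ) : Measurable fun ω => eulerState h c (b ω) :=
    (measurable_pi_lambda _ (measurable_eulerState h c)).comp hb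
  have hℓ := measurable_eulerLogLik h a n
  have htr := measurable_truncSeq n
  have htail (c : ℕ → ℝ) (hc : ∀ k, |c k| ≤ A) :
      P {ω | K ≤ |eulerLogLik h a n (eulerState h c (b ω))|} ≤
        ENNReal.ofReal ((1 + 3 * A ^ 2 * t ^ 2 * Real.exp (2 * A * t)) / K) := by
    obtain ⟨h1, h2⟩ := eulerLogLik_moment a c ha hc hb hind hlaw hn
    have h3 := mul_meas_ge_le_integral_of_nonneg (ae_of_all P fun ω => abs_nonneg
      (eulerLogLik h a n (eulerState h c (b ω)))) h1.abs K
    rw [← ofReal_measureReal]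
    refine ENNReal.ofReal_le_ofReal ?_
    rw [le_div_iff₀ hK, mul_comm]
    exact h3.trans h2
  have hset (c : ℕ → ℝ) :
      MeasurableSet {ω | K ≤ |eulerLogLik h a n (eulerState h c (b ω))|} :=
    measurableSet_le measurable_const (hℓ.comp (hS c)).abs
  have hind_le (c : ℕ → ℝ) (hc : ∀ k, |c k| ≤ A) :
      ∫⁻ ω, {ω | K ≤ |eulerLogLik h a n (eulerState h c (b ω))|}.indicator 1 ω ∂P ≤
        ENNReal.ofReal ((1 + 3 * A ^ 2 * t ^ 2 * Real.exp (2 * A * t)) / K) := by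
    rw [lintegral_indicator_one (hset c)]
    exact htail c hc
  constructor
  · rw [lintegral_eulerState hh a hb hind hlaw n hG]
    have hm : Measurable fun ω => G (truncSeq n (eulerState h 0 (b ω))) *
        ENNReal.ofReal (Real.exp (eulerLogLik h a n (eulerState h 0 (b ω)))) := by
      have := hS 0
      fun_prop
    refine le_trans ?_ (add_le_add_right (hind_le 0 fun k => by simpa using hA) _)
    rw [← lintegral_const_mul _ hm, ← lintegral_add_left (hm.const_mul _)]
    refine lintegral_mono fun ω => ?_
    dsimp only
    by_cases hω : K ≤ |eulerLogLik h a n (eulerState h 0 (b ω))|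
    · rw [Set.indicator_of_mem (by exact hω)]
      exact (hG1 _).trans le_add_self
    · have h1 : 0 ≤ K + eulerLogLik h a n (eulerState h 0 (b ω)) := by
        linarith [(abs_lt.1 (not_le.1 hω)).1]
      have h2 : 1 ≤ ENNReal.ofReal (Real.exp K) *
          ENNReal.ofReal (Real.exp (eulerLogLik h a n (eulerState h 0 (b ω)))) := by
        rw [← ENNReal.ofReal_mul (Real.exp_pos K).le, ← Real.exp_add]
        exact ENNReal.one_le_ofReal.2 (Real.one_le_exp h1)
      refine le_trans ?_ le_self_add
      calc G (truncSeq n (eulerState h 0 (b ω)))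
          ≤ G (truncSeq n (eulerState h 0 (b ω))) * (ENNReal.ofReal (Real.exp K) *
            ENNReal.ofReal (Real.exp (eulerLogLik h a n (eulerState h 0 (b ω))))) :=
            le_mul_of_one_le_right' h2
        _ = _ := by ring
  · have hset' : MeasurableSet {x : ℕ → ℝ | |eulerLogLik h a n x| < K} :=
      measurableSet_lt hℓ.abs measurable_const
    have hG' : Measurable ({x : ℕ → ℝ | |eulerLogLik h a n x| < K}.indicator G) :=
      hG.indicator hset'
    calc ∫⁻ ω, G (truncSeq n (eulerState h a (b ω))) ∂P
        ≤ ∫⁻ ω, ({x : ℕ → ℝ | |eulerLogLik h a n x| < K}.indicator G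
              (truncSeq n (eulerState h a (b ω))) +
            {ω | K ≤ |eulerLogLik h a n (eulerState h a (b ω))|}.indicator 1 ω) ∂P := by
          refine lintegral_mono fun ω => ?_
          dsimp only
          by_cases hω : K ≤ |eulerLogLik h a n (eulerState h a (b ω))|
          · rw [Set.indicator_of_mem (s := {ω | K ≤ _}) (by exact hω)]
            exact (hG1 _).trans le_add_self
          · rw [Set.indicator_of_mem (s := {x : ℕ → ℝ | |eulerLogLik h a n x| < K})
              (by simpa [eulerLogLik_truncSeq] using hω)]
            exact le_self_add
      _ = ∫⁻ ω, {x : ℕ → ℝ | |eulerLogLik h a n x| < K}.indicator G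
              (truncSeq n (eulerState h a (b ω))) ∂P +
            ∫⁻ ω, {ω | K ≤ |eulerLogLik h a n (eulerState h a (b ω))|}.indicator 1 ω ∂P :=
          lintegral_add_left (hG'.comp (htr.comp (hS a))) _
      _ ≤ _ := by
          refine add_le_add ?_ (hind_le a ha)
          rw [lintegral_eulerState hh a hb hind hlaw n hG',
            ← lintegral_const_mul _ (by have := hS 0; fun_prop)]
          refine lintegral_mono fun ω => ?_
          dsimp only
          by_cases hω : |eulerLogLik h a n (eulerState h 0 (b ω))| < K
          · rw [Set.indicator_of_mem (by simpa [eulerLogLik_truncSeq] using hω), mul_comm]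
            gcongr
            exact (abs_lt.1 hω).2.le
          · rw [Set.indicator_of_notMem (by simpa [eulerLogLik_truncSeq] using hω)]
            simp

/-- A uniform comparison of the laws of `Z n` and `W n` passes to almost sure limits in the form
of absolute continuity. -/
lemma map_absolutelyContinuous_of_tendsto {E : Type*} [TopologicalSpace E]
    [TopologicalSpace.PseudoMetrizableSpace E] [MeasurableSpace E] [BorelSpace E]
    {P : Measure Ω} [IsProbabilityMeasure P] {Z W : Ω → E} {Zn Wn : ℕ → Ω → E}
    (hZ : AEMeasurable Z P) (hW : AEMeasurable W P) (hZn : ∀ n, Measurable (Zn n))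
    (hWn : ∀ n, Measurable (Wn n))
    (hZt : ∀ᵐ ω ∂P, Tendsto (fun n => Zn n ω) atTop (𝓝 (Z ω)))
    (hWt : ∀ᵐ ω ∂P, Tendsto (fun n => Wn n ω) atTop (𝓝 (W ω))) {C : ℝ}
    (hle : ∀ K : ℝ, 0 < K → ∀ n, ∀ G : E → ℝ≥0∞, Measurable G → (∀ x, G x ≤ 1) →
      ∫⁻ ω, G (Zn n ω) ∂P ≤
        ENNReal.ofReal (Real.exp K) * ∫⁻ ω, G (Wn n ω) ∂P + ENNReal.ofReal (C / K)) :
    P.map Z ≪ P.map W := by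
  have hfinZ : IsFiniteMeasure (P.map Z) := Measure.isFiniteMeasure_map P Z
  have hfinW : IsFiniteMeasure (P.map W) := Measure.isFiniteMeasure_map P W
  refine absolutelyContinuous_of_lintegral_le fun ε hε => ?_
  have hlim : Tendsto (fun K : ℝ => ENNReal.ofReal (C / K)) atTop (𝓝 0) := by
    simpa using ENNReal.tendsto_ofReal (tendsto_const_nhds.div_atTop tendsto_id)
  obtain ⟨K, hKε, hK⟩ := ((hlim.eventually (gt_mem_nhds hε)).and (eventually_gt_atTop 0)).exists
  refine ⟨ENNReal.ofReal (Real.exp K), ENNReal.ofReal_ne_top, fun F hF => ?_⟩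
  have hFm : Measurable fun x => (F x : ℝ≥0∞) :=
    F.continuous.measurable.coe_nnreal_ennreal
  have hF1 (x : E) : (F x : ℝ≥0∞) ≤ 1 := by exact_mod_cast hF x
  have hconv {Y : Ω → E} {Yn : ℕ → Ω → E} (hYn : ∀ n, Measurable (Yn n))
      (hY : ∀ᵐ ω ∂P, Tendsto (fun n => Yn n ω) atTop (𝓝 (Y ω))) :
      Tendsto (fun n => ∫⁻ ω, (F (Yn n ω) : ℝ≥0∞) ∂P) atTop
        (𝓝 (∫⁻ ω, (F (Y ω) : ℝ≥0∞) ∂P)) := by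
    refine tendsto_lintegral_of_dominated_convergence (fun _ => 1)
      (fun n => hFm.comp (hYn n)) (fun n => ae_of_all _ fun ω => hF1 _) (by simp) ?_
    filter_upwards [hY] with ω hω
    exact ENNReal.tendsto_coe.2 ((F.continuous.tendsto _).comp hω)
  rw [lintegral_map' hFm.aemeasurable hZ, lintegral_map' hFm.aemeasurable hW]
  refine (le_of_tendsto_of_tendsto' (hconv hZn hZt) ((ENNReal.Tendsto.const_mul (hconv hWn hWt)
    (Or.inr ENNReal.ofReal_ne_top)).add_const (ENNReal.ofReal (C / K)))
    fun n => hle K hK n _ hFm hF1).trans ?_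
  gcongr

/-- Global error of the Euler scheme for `X = β - D`, where `D' = a X`. -/
lemma abs_eulerState_sub_le {a β D : ℝ → ℝ} {A t h η : ℝ} (hh : 0 ≤ h)
    (hη : 0 ≤ η) (hA : ∀ u, |a u| ≤ A) (h0 : β 0 - D 0 = 0)
    (hD : ∀ u ∈ Set.Icc 0 t, HasDerivWithinAt D (a u * (β u - D u)) (Set.Icc 0 t) u)
    (hmod : ∀ u ∈ Set.Icc 0 t, ∀ v ∈ Set.Icc 0 t, |u - v| ≤ h →
      |a u * (β u - D u) - a v * (β v - D v)| ≤ η) (k : ℕ) (hk : k * h ≤ t) :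
    |eulerState h (fun j => a (j * h)) (fun j => β ((j + 1) * h) - β (j * h)) k -
      (β (k * h) - D (k * h))| ≤ k * h * η * (1 + h * A) ^ k := by
  have hA0 : 0 ≤ A := (abs_nonneg _).trans (hA 0)
  induction k with
  | zero => simp [eulerState, h0]
  | succ k ih =>
    push_cast at hk ⊢
    have hkh : 0 ≤ k * h := by positivity
    have hk' : k * h ≤ t := by nlinarith
    specialize ih hk'
    set S := eulerState h (fun j => a (j * h)) (fun j => β ((j + 1) * h) - β (j * h)) with hS
    set u := k * h with hu
    set v := (k + 1) * h with hv
    have huv : v = u + h := by rw [hu, hv]; ring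
    have hsub : Set.Icc u v ⊆ Set.Icc 0 t := Set.Icc_subset_Icc hkh hk
    have hmean : |D v - D u - h * (a u * (β u - D u))| ≤ η * h := by
      have := Convex.norm_image_sub_le_of_norm_hasDerivWithin_le
        (f := fun x => D x - x * (a u * (β u - D u))) (s := Set.Icc u v) (C := η) (x := u)
        (y := v) (f' := fun x => a x * (β x - D x) - 1 * (a u * (β u - D u)))
        (fun x hx => ((hD x (hsub hx)).mono hsub).sub
          ((hasDerivWithinAt_id x _).mul_const _))
        (fun x hx => by
          rw [one_mul]
          refine hmod x (hsub hx) u (hsub ⟨le_rfl, by linarith⟩) ?_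
          rw [abs_of_nonneg (by linarith [hx.1])]
          linarith [hx.2])
        (convex_Icc u v) ⟨le_rfl, by linarith⟩ ⟨by linarith, le_rfl⟩
      simp only [Real.norm_eq_abs, huv, add_sub_cancel_left, abs_of_nonneg hh] at this
      rw [huv]
      convert this using 2
      ring
    have hrec : S (k + 1) - (β v - D v) = (1 - h * a u) * (S k - (β u - D u)) +
        (D v - D u - h * (a u * (β u - D u))) := by
      simp only [hS, eulerState, ← hu, ← hv]
      ring
    have hfac : |1 - h * a u| ≤ 1 + h * A := by
      have := abs_le.1 (hA u)
      exact abs_le.2 ⟨by nlinarith, by nlinarith⟩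
    have hone : 1 ≤ (1 + h * A) ^ (k + 1) := one_le_pow₀ (by nlinarith [mul_nonneg hh hA0])
    rw [hrec]
    calc |(1 - h * a u) * (S k - (β u - D u)) + (D v - D u - h * (a u * (β u - D u)))|
        ≤ |1 - h * a u| * |S k - (β u - D u)| + |D v - D u - h * (a u * (β u - D u))| := by
          rw [← abs_mul]; exact abs_add_le _ _
      _ ≤ (1 + h * A) * (u * η * (1 + h * A) ^ k) + η * h * (1 + h * A) ^ (k + 1) := by
          gcongr
          exact hmean.trans (le_mul_of_one_le_right (by positivity) hone)
      _ = v * η * (1 + h * A) ^ (k + 1) := by rw [huv]; ring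

/-- Convergence of the Euler scheme for `X = β - D`, where `D' = a X`. -/
lemma tendsto_eulerState {a β D : ℝ → ℝ} {A t : ℝ} (ht : 0 < t) (hA : ∀ u, |a u| ≤ A)
    (ha : ContinuousOn a (Set.Icc 0 t)) (hβ : ContinuousOn β (Set.Icc 0 t)) (h0 : β 0 - D 0 = 0)
    (hD : ∀ u ∈ Set.Icc 0 t, HasDerivWithinAt D (a u * (β u - D u)) (Set.Icc 0 t) u)
    {s : ℝ} (hs : s ∈ Set.Icc 0 t) {h : ℕ → ℝ} (hpos : ∀ n, 0 < h n)
    (hh : Tendsto h atTop (𝓝 0)) :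
    Tendsto (fun n => eulerState (h n) (fun j => a (j * h n))
      (fun j => β ((j + 1) * h n) - β (j * h n)) ⌊s / h n⌋₊) atTop (𝓝 (β s - D s)) := by
  have hA0 : 0 ≤ A := (abs_nonneg _).trans (hA 0)
  have hDc : ContinuousOn D (Set.Icc 0 t) := fun u hu => (hD u hu).continuousWithinAt
  have hX : ContinuousOn (fun u => β u - D u) (Set.Icc 0 t) := hβ.sub hDc
  have hg := isCompact_Icc.uniformContinuousOn_of_continuous (ha.mul hX)
  have hle (n : ℕ) : ⌊s / h n⌋₊ * h n ≤ s := by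
    rw [← le_div_iff₀ (hpos n)]
    exact Nat.floor_le (div_nonneg hs.1 (hpos n).le)
  have hge (n : ℕ) : s - h n ≤ ⌊s / h n⌋₊ * h n := by
    have := Nat.lt_floor_add_one (s / h n)
    rw [div_lt_iff₀ (hpos n)] at this
    linarith
  have hgrid : Tendsto (fun n => (⌊s / h n⌋₊ : ℝ) * h n) atTop (𝓝 s) :=
    tendsto_of_tendsto_of_tendsto_of_le_of_le (by simpa using tendsto_const_nhds.sub hh)
      tendsto_const_nhds hge hle
  have hXt : Tendsto (fun n => β (⌊s / h n⌋₊ * h n) - D (⌊s / h n⌋₊ * h n)) atTop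
      (𝓝 (β s - D s)) :=
    (hX s hs).tendsto.comp (tendsto_nhdsWithin_iff.2 ⟨hgrid, Eventually.of_forall fun n =>
      ⟨mul_nonneg (Nat.cast_nonneg _) (hpos n).le, (hle n).trans hs.2⟩⟩)
  refine (tendsto_iff_of_dist ?_).2 hXt
  rw [Metric.tendsto_atTop]
  intro ε hε
  set M := t * Real.exp (A * t) with hM
  have hMpos : 0 < M := by positivity
  have hη : 0 < ε / (2 * M) := by positivity
  obtain ⟨δ, hδ, hmod⟩ := Metric.uniformContinuousOn_iff.1 hg _ hη
  obtain ⟨N, hN⟩ := eventually_atTop.1 (hh.eventually (gt_mem_nhds hδ))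
  refine ⟨N, fun n hn => ?_⟩
  have hk : ⌊s / h n⌋₊ * h n ≤ t := (hle n).trans hs.2
  have herr := abs_eulerState_sub_le (hpos n).le hη.le hA h0 hD (fun u hu v hv huv =>
    (hmod u hu v hv (huv.trans_lt (hN n hn))).le) _ hk
  have h1 : 0 ≤ 1 + h n * A := by have := mul_nonneg (hpos n).le hA0; linarith
  have hpow : (1 + h n * A) ^ ⌊s / h n⌋₊ ≤ Real.exp (A * t) := by
    calc (1 + h n * A) ^ ⌊s / h n⌋₊ ≤ Real.exp (h n * A) ^ ⌊s / h n⌋₊ := by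
          have := Real.add_one_le_exp (h n * A)
          gcongr
          linarith
      _ = Real.exp (A * (⌊s / h n⌋₊ * h n)) := by rw [← Real.exp_nat_mul]; ring_nf
      _ ≤ Real.exp (A * t) := by gcongr
  rw [Real.dist_0_eq_abs, abs_of_nonneg dist_nonneg, Real.dist_eq]
  calc _ ≤ _ := herr
    _ ≤ t * (ε / (2 * M)) * Real.exp (A * t) := by
      have h2 := pow_nonneg h1 ⌊s / h n⌋₊
      gcongr
    _ = ε / 2 := by rw [hM]; field_simp
    _ < ε := by linarith

/-- The drift coefficient of the bridge, frozen after time `t`. -/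
def bridgeDrift (T α t u : ℝ) : ℝ := α / (T - min u t)

lemma abs_bridgeDrift_le {T t : ℝ} (ht : t < T) (α u : ℝ) :
    |bridgeDrift T α t u| ≤ |α| / (T - t) := by
  have h : T - t ≤ T - min u t := by linarith [min_le_right u t]
  have h' : 0 < T - t := sub_pos.2 ht
  rw [bridgeDrift, abs_div, abs_of_pos (h'.trans_le h)]
  gcongr

lemma continuous_bridgeDrift {T t : ℝ} (ht : t < T) (α : ℝ) : Continuous (bridgeDrift T α t) := by
  refine continuous_const.div (by fun_prop) fun u => ?_
  linarith [min_le_right u t]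

lemma bridgeDrift_zero (T t : ℝ) : bridgeDrift T 0 t = 0 := by
  ext u; simp [bridgeDrift]

/-- The drift part `α (T-s)^α ∫₀ˢ (T-u)^(-α-1) β u du` of the bridge driven by `β`. -/
def bridgeCorrection (T α : ℝ) (β : ℝ → ℝ) (s : ℝ) : ℝ :=
  α * (T - s) ^ α * ∫ u in (0:ℝ)..s, (T - u) ^ (-α - 1) * β u

lemma alphaWienerBridge_eq {Ω : Type*} (T α : ℝ) (B : ℝ → Ω → ℝ) {s : ℝ} (hs : 0 ≤ s)
    (ω : Ω) :
    alphaWienerBridge T α B s ω = B s ω - bridgeCorrection T α (fun u => B u ω) s := by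
  rw [alphaWienerBridge, bridgeCorrection, intervalIntegral.integral_of_le hs]

lemma hasDerivAt_bridgeCorrection {T : ℝ} (hT : 0 < T) (α : ℝ) {β : ℝ → ℝ} (hβ : Continuous β)
    {s : ℝ} (hs : s < T) :
    HasDerivAt (bridgeCorrection T α β) (α / (T - s) * (β s - bridgeCorrection T α β s)) s := by
  have hc : ContinuousOn (fun u => (T - u) ^ (-α - 1) * β u) (Set.Iio T) :=
    ((continuousOn_const.sub continuousOn_id).rpow_const
      fun u hu => Or.inl (sub_pos.2 hu).ne').mul hβ.continuousOn
  have hint : HasDerivAt (fun s => ∫ u in (0:ℝ)..s, (T - u) ^ (-α - 1) * β u)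
      ((T - s) ^ (-α - 1) * β s) s := by
    refine intervalIntegral.integral_hasDerivAt_right ?_ ?_ (hc.continuousAt (Iio_mem_nhds hs))
    · refine (hc.mono fun u hu => ?_).intervalIntegrable
      exact hu.2.trans_lt (max_lt hT hs)
    · exact hc.stronglyMeasurableAtFilter isOpen_Iio s hs
  have hpos : 0 < T - s := sub_pos.2 hs
  have hpow : HasDerivAt (fun s => (T - s) ^ α) (-1 * α * (T - s) ^ (α - 1)) s :=
    ((hasDerivAt_id s).const_sub T).rpow_const (Or.inl hpos.ne')
  refine ((hpow.const_mul α).mul hint).congr_deriv ?_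
  have h1 : (T - s) ^ (α - 1) = (T - s) ^ α / (T - s) := Real.rpow_sub_one hpos.ne' α
  have h2 : (T - s) ^ α * (T - s) ^ (-α - 1) = 1 / (T - s) := by
    rw [← Real.rpow_add hpos, show α + (-α - 1) = -1 by ring, Real.rpow_neg_one, one_div]
  rw [h1, bridgeCorrection]
  linear_combination (α * β s) * h2

lemma continuousOn_alphaWienerBridge {Ω : Type*} {B : ℝ → Ω → ℝ} {T t : ℝ}
    (ht : t ∈ Set.Ioo 0 T) (α : ℝ) {ω : Ω} (hω : Continuous fun u => B u ω) :
    ContinuousOn (fun s => alphaWienerBridge T α B s ω) (Set.Icc 0 t) := by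
  have hT : 0 < T := ht.1.trans ht.2
  have : ContinuousOn (fun s => B s ω - bridgeCorrection T α (fun u => B u ω) s) (Set.Icc 0 t) :=
    hω.continuousOn.sub fun s hs =>
      (hasDerivAt_bridgeCorrection hT α hω (hs.2.trans_lt ht.2)).continuousAt.continuousWithinAt
  exact this.congr fun s hs => alphaWienerBridge_eq T α B hs.1 ω

/-- The increments of `B` along the grid of mesh `h`. -/
def gridIncr (B : ℝ → Ω → ℝ) (h : ℝ) (ω : Ω) (k : ℕ) : ℝ := B ((k + 1) * h) ω - B (k * h) ω

lemma tendsto_eulerState_bridge {Ω : Type*} {B : ℝ → Ω → ℝ} {T t : ℝ}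
    (ht : t ∈ Set.Ioo 0 T) (α : ℝ) {ω : Ω} (hω : Continuous fun u => B u ω) (h0 : B 0 ω = 0)
    {s : ℝ} (hs : s ∈ Set.Icc 0 t)
    {h : ℕ → ℝ} (hpos : ∀ n, 0 < h n) (hh : Tendsto h atTop (𝓝 0)) :
    Tendsto (fun n => eulerState (h n) (fun j => bridgeDrift T α t (j * h n))
      (gridIncr B (h n) ω) ⌊s / h n⌋₊) atTop (𝓝 (alphaWienerBridge T α B s ω)) := by
  rw [alphaWienerBridge_eq T α B hs.1 ω]
  refine tendsto_eulerState (β := fun u => B u ω) ht.1 (abs_bridgeDrift_le ht.2 α)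
    (continuous_bridgeDrift ht.2 α).continuousOn hω.continuousOn (by simp [bridgeCorrection, h0])
    (fun u hu => ?_) hs hpos hh
  have := hasDerivAt_bridgeCorrection (ht.1.trans ht.2) α hω (hu.2.trans_lt ht.2)
  rw [bridgeDrift, min_eq_left hu.2]
  exact this.hasDerivWithinAt

variable {P : Measure Ω} {B : ℝ → Ω → ℝ}

namespace IsStandardWiener

lemma measurable_gridIncr (hB : IsStandardWiener P B) (h : ℝ) : Measurable (gridIncr B h) :=
  measurable_pi_lambda _ fun _ => (hB.meas _).sub (hB.meas _)

lemma map_gridIncr (hB : IsStandardWiener P B) (h : ℝ≥0) (k : ℕ) :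
    P.map (fun ω => gridIncr B h ω k) = gaussianReal 0 h := by
  have := hB.incr_law (k * h) ((k + 1) * h) (by positivity) (by gcongr; simp)
  rwa [show ((k:ℝ) + 1) * h - k * h = h by ring, Real.toNNReal_coe] at this

lemma indepFun_gridIncr (hB : IsStandardWiener P B) (h : ℝ≥0) (k : ℕ) :
    IndepFun (fun ω => gridIncr B h ω k) (fun ω => pastSeq k (gridIncr B h ω)) P := by
  have hle {i : ℕ} (hi : i ≤ k) : (i * h : ℝ) ∈ Set.Icc (0:ℝ) (k * h) :=
    ⟨by positivity, by gcongr⟩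
  let φ (p : Set.Icc (0:ℝ) (k * h) → ℝ) (j : ℕ) : ℝ :=
    if hj : j < k then p ⟨(j + 1 : ℕ) * h, hle hj⟩ - p ⟨j * h, hle hj.le⟩ else 0
  have hφ : Measurable φ := by
    refine measurable_pi_lambda _ fun j => ?_
    by_cases hj : j < k
    · simp only [φ, hj, dif_pos]
      exact (measurable_pi_apply _).sub (measurable_pi_apply _)
    · simp only [φ, hj, dif_neg, not_false_eq_true, measurable_const]
  have hpast : (fun ω => pastSeq k (gridIncr B h ω)) = φ ∘ fun ω u => B u.1 ω := by
    ext ω j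
    by_cases hj : j < k <;> simp [φ, pastSeq, gridIncr, hj]
  rw [hpast]
  exact (hB.incr_indep (k * h) ((k + 1) * h) (by positivity) (by gcongr; simp)).comp
    measurable_id hφ

end IsStandardWiener

/-- Reading off the grid values at the times `s i`, for a grid of mesh `h`. -/
def gridRead (h : ℝ) (s : ℕ → ℝ) (x : ℕ → ℝ) (i : ℕ) : ℝ := x ⌊s i / h⌋₊

lemma measurable_gridRead (h : ℝ) (s : ℕ → ℝ) : Measurable (gridRead h s) :=
  measurable_pi_lambda _ fun _ => measurable_pi_apply _

lemma gridRead_truncSeq {n : ℕ} {h t : ℝ} (hh : 0 < h) (hn : n * h = t) {s : ℕ → ℝ}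
    (hs : ∀ i, s i ∈ Set.Icc 0 t) (x : ℕ → ℝ) :
    gridRead h s (truncSeq n x) = gridRead h s x := by
  ext i
  have : ⌊s i / h⌋₊ ≤ n := by
    rw [← Nat.floor_natCast (R := ℝ) n]
    exact Nat.floor_mono (by rw [div_le_iff₀ hh, hn]; exact (hs i).2)
  simp [gridRead, truncSeq, this]

/-- The mesh of the uniform grid with `n + 1` cells on `[0, t]`. -/
def mesh (t : ℝ≥0) (n : ℕ) : ℝ≥0 := t / (n + 1)

lemma mesh_pos {t : ℝ≥0} (ht : 0 < t) (n : ℕ) : 0 < mesh t n := by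
  unfold mesh; positivity

lemma succ_mul_mesh (t : ℝ≥0) (n : ℕ) : ((n + 1 : ℕ) : ℝ) * mesh t n = t := by
  simp only [mesh]
  push_cast
  field_simp

lemma tendsto_mesh (t : ℝ≥0) : Tendsto (fun n => (mesh t n : ℝ)) atTop (𝓝 0) := by
  simpa [mesh, div_eq_mul_inv] using
    (tendsto_inv_atTop_zero.comp (tendsto_natCast_atTop_atTop.atTop_add
      (tendsto_const_nhds (x := (1:ℝ))))).const_mul (t : ℝ)

section Evaluation

variable {T : ℝ} {t : ℝ≥0} {s : ℕ → ℝ}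

/-- The Euler approximation of the bridge at the times `s i`. -/
def eulerBridge (T α : ℝ) (t : ℝ≥0) (B : ℝ → Ω → ℝ) (s : ℕ → ℝ) (n : ℕ) (ω : Ω) : ℕ → ℝ :=
  gridRead (mesh t n) s (eulerState (mesh t n) (fun j => bridgeDrift T α t (j * mesh t n))
    (gridIncr B (mesh t n) ω))

lemma measurable_eulerBridge (hB : IsStandardWiener P B) (α : ℝ) (n : ℕ) :
    Measurable (eulerBridge T α t B s n) :=
  (measurable_gridRead _ _).comp
    ((measurable_pi_lambda _ fun k => measurable_eulerState _ _ k).comp (hB.measurable_gridIncr _))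

lemma tendsto_eulerBridge (hB : IsStandardWiener P B) (ht : (t : ℝ) ∈ Set.Ioo 0 T)
    (hs : ∀ i, s i ∈ Set.Icc 0 (t : ℝ)) (α : ℝ) :
    ∀ᵐ ω ∂P, Tendsto (fun n => eulerBridge T α t B s n ω) atTop
      (𝓝 fun i => alphaWienerBridge T α B (s i) ω) := by
  filter_upwards [hB.cont, hB.init] with ω hω h0
  exact tendsto_pi_nhds.2 fun i => tendsto_eulerState_bridge ht α hω h0 (hs i)
    (fun n => NNReal.coe_pos.2 (mesh_pos (NNReal.coe_pos.1 ht.1) n)) (tendsto_mesh t)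

lemma aemeasurable_alphaWienerBridge (hB : IsStandardWiener P B) (ht : (t : ℝ) ∈ Set.Ioo 0 T)
    (hs : ∀ i, s i ∈ Set.Icc 0 (t : ℝ)) (α : ℝ) :
    AEMeasurable (fun ω i => alphaWienerBridge T α B (s i) ω) P :=
  aemeasurable_of_tendsto_metrizable_ae atTop
    (fun n => (measurable_eulerBridge hB α n).aemeasurable) (tendsto_eulerBridge hB ht hs α)

variable [IsProbabilityMeasure P]

lemma exists_lintegral_eulerBridge_le (hB : IsStandardWiener P B) (ht : (t : ℝ) ∈ Set.Ioo 0 T)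
    (hs : ∀ i, s i ∈ Set.Icc 0 (t : ℝ)) (α : ℝ) :
    ∃ C : ℝ, ∀ K > 0, ∀ n, ∀ G : (ℕ → ℝ) → ℝ≥0∞, Measurable G → (∀ x, G x ≤ 1) →
      ∫⁻ ω, G (eulerBridge T 0 t B s n ω) ∂P ≤ ENNReal.ofReal (Real.exp K) *
        ∫⁻ ω, G (eulerBridge T α t B s n ω) ∂P + ENNReal.ofReal (C / K) ∧
      ∫⁻ ω, G (eulerBridge T α t B s n ω) ∂P ≤ ENNReal.ofReal (Real.exp K) *
        ∫⁻ ω, G (eulerBridge T 0 t B s n ω) ∂P + ENNReal.ofReal (C / K) := by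
  refine ⟨1 + 3 * (|α| / (T - t)) ^ 2 * t ^ 2 * Real.exp (2 * (|α| / (T - t)) * t),
    fun K hK n G hG hG1 => ?_⟩
  have hm := mesh_pos (NNReal.coe_pos.1 ht.1) n
  have key := lintegral_eulerState_le hm.ne' (fun j => bridgeDrift T α t (j * mesh t n))
    (fun j => abs_bridgeDrift_le ht.2 α _) (hB.measurable_gridIncr _)
    (hB.indepFun_gridIncr (mesh t n)) (hB.map_gridIncr (mesh t n)) (succ_mul_mesh t n)
    (hG.comp (measurable_gridRead (mesh t n) s)) (fun x => hG1 _) hK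
  simp only [Function.comp_apply,
    gridRead_truncSeq (NNReal.coe_pos.2 hm) (succ_mul_mesh t n) hs] at key
  have hzero : (fun j : ℕ => bridgeDrift T 0 t (j * mesh t n)) = 0 := by
    rw [bridgeDrift_zero]
    rfl
  simpa only [eulerBridge, hzero] using key

/-- The laws of the `α`-bridge and of `B` at countably many times are equivalent. -/
lemma map_alphaWienerBridge_absolutelyContinuous (hB : IsStandardWiener P B)
    (ht : (t : ℝ) ∈ Set.Ioo 0 T) (hs : ∀ i, s i ∈ Set.Icc 0 (t : ℝ)) (α : ℝ) :
    P.map (fun ω i => alphaWienerBridge T α B (s i) ω) ≪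
        P.map (fun ω i => alphaWienerBridge T 0 B (s i) ω) ∧
      P.map (fun ω i => alphaWienerBridge T 0 B (s i) ω) ≪
        P.map (fun ω i => alphaWienerBridge T α B (s i) ω) := by
  obtain ⟨C, hC⟩ := exists_lintegral_eulerBridge_le hB ht hs α
  exact ⟨map_absolutelyContinuous_of_tendsto (aemeasurable_alphaWienerBridge hB ht hs α)
      (aemeasurable_alphaWienerBridge hB ht hs 0) (measurable_eulerBridge hB α)
      (measurable_eulerBridge hB 0) (tendsto_eulerBridge hB ht hs α)
      (tendsto_eulerBridge hB ht hs 0) fun K hK n G hG hG1 => (hC K hK n G hG hG1).2,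
    map_absolutelyContinuous_of_tendsto (aemeasurable_alphaWienerBridge hB ht hs 0)
      (aemeasurable_alphaWienerBridge hB ht hs α) (measurable_eulerBridge hB 0)
      (measurable_eulerBridge hB α) (tendsto_eulerBridge hB ht hs 0)
      (tendsto_eulerBridge hB ht hs α) fun K hK n G hG hG1 => (hC K hK n G hG hG1).1⟩

end Evaluation

lemma exists_seq_Icc_subset_closure {t : ℝ} (ht : 0 ≤ t) :
    ∃ s : ℕ → ℝ, (∀ i, s i ∈ Set.Icc 0 t) ∧ Set.Icc 0 t ⊆ closure (range s) := by
  have : Nonempty (Set.Icc 0 t) := ⟨⟨0, le_rfl, ht⟩⟩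
  let s := TopologicalSpace.denseSeq (Set.Icc 0 t)
  refine ⟨fun i => (s i : ℝ), fun i => (s i).2, fun u hu => ?_⟩
  have := image_closure_subset_closure_image (f := ((↑) : Set.Icc 0 t → ℝ))
    continuous_subtype_val (mem_image_of_mem _ (TopologicalSpace.denseRange_denseSeq _ ⟨u, hu⟩))
  rwa [← range_comp] at this

namespace ContPathIcc

variable {t : ℝ}

lemma continuousOn_abs_sub (x y : ContPathIcc t) :
    ContinuousOn (fun u => |x.1 u - y.1 u|) (Set.Icc 0 t) :=
  (x.2.sub y.2).abs

/-- Sup-distance balls are determined by the values at a dense sequence of times. -/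
lemma supDist_lt_iff (ht : 0 ≤ t) {s : ℕ → ℝ} (hs : ∀ i, s i ∈ Set.Icc 0 t)
    (hd : Set.Icc 0 t ⊆ closure (range s)) (x y : ContPathIcc t) (r : ℝ) :
    supDist t x.1 y.1 < r ↔ ∃ q : ℚ, (q : ℝ) < r ∧ ∀ i, |x.1 (s i) - y.1 (s i)| ≤ q := by
  have hc := continuousOn_abs_sub x y
  constructor
  · intro h
    obtain ⟨q, hq, hqr⟩ := exists_rat_btwn h
    refine ⟨q, hqr, fun i => le_trans ?_ hq.le⟩
    exact le_csSup (isCompact_Icc.bddAbove_image hc) (mem_image_of_mem _ (hs i))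
  · rintro ⟨q, hqr, hq⟩
    refine (csSup_le ((nonempty_Icc.2 ht).image _) ?_).trans_lt hqr
    rintro _ ⟨u, hu, rfl⟩
    exact ContinuousWithinAt.closure_le (hd hu) ((hc u hu).mono (range_subset_iff.2 hs))
      continuousWithinAt_const (by rintro _ ⟨i, rfl⟩; exact hq i)

lemma exists_measurableSet_preimage_eq (ht : 0 ≤ t) {s : ℕ → ℝ} (hs : ∀ i, s i ∈ Set.Icc 0 t)
    (hd : Set.Icc 0 t ⊆ closure (range s)) {S : Set (ContPathIcc t)}
    (hS : MeasurableSet[borelSup t] S) :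
    ∃ S' : Set (ℕ → ℝ), MeasurableSet S' ∧ (fun (y : ContPathIcc t) i => y.1 (s i)) ⁻¹' S' = S := by
  suffices h : borelSup t ≤ MeasurableSpace.comap (fun (y : ContPathIcc t) i => y.1 (s i))
      inferInstance from h S hS
  refine MeasurableSpace.generateFrom_le ?_
  rintro _ ⟨x, r, rfl⟩
  refine ⟨{z | ∃ q : ℚ, (q : ℝ) < r ∧ ∀ i, |x.1 (s i) - z i| ≤ q}, ?_, ?_⟩
  · simp only [ofPred_exists, ofPred_and, ofPred_forall]
    exact .iUnion fun q => (MeasurableSet.const _).inter <| .iInter fun i =>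
      measurableSet_le (by fun_prop) measurable_const
  · ext y
    exact (supDist_lt_iff ht hs hd x y r).symm

/-- A path as an element of `C([0,t], ℝ)`. -/
def toContinuousMap (y : ContPathIcc t) : C(Set.Icc 0 t, ℝ) :=
  ⟨(Set.Icc 0 t).domRestrict y.1, y.2.domRestrict⟩

lemma measurable_toContinuousMap (ht : 0 ≤ t) :
    @Measurable _ _ (borelSup t) (borel C(Set.Icc 0 t, ℝ)) (toContinuousMap (t := t)) := by
  have hbasis : TopologicalSpace.IsTopologicalBasis
      {U : Set C(Set.Icc 0 t, ℝ) | ∃ f r, U = Metric.ball f r} := by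
    refine TopologicalSpace.isTopologicalBasis_of_isOpen_of_nhds ?_ fun f U hf hU => ?_
    · rintro _ ⟨f, r, rfl⟩
      exact Metric.isOpen_ball
    · obtain ⟨r, hr, hrU⟩ := Metric.isOpen_iff.1 hU f hf
      exact ⟨_, ⟨f, r, rfl⟩, Metric.mem_ball_self hr, hrU⟩
  rw [borel_eq_generateFrom_of_subbasis hbasis.eq_generateFrom]
  refine @measurable_generateFrom _ _ (borelSup t) _ _ ?_
  rintro _ ⟨f, r, rfl⟩
  have hf : ∀ u : Set.Icc 0 t, Set.IccExtend ht f u = f u := Set.IccExtend_val ht f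
  refine MeasurableSpace.measurableSet_generateFrom
    ⟨⟨Set.IccExtend ht f, f.continuous.Icc_extend'.continuousOn⟩, r, ?_⟩
  ext y
  rw [mem_preimage, Metric.mem_ball', ContinuousMap.dist_eq_iSup]
  change _ ↔ sSup _ < r
  rw [sSup_image']
  simp only [hf]
  rfl

lemma measurable_apply {u : ℝ} (hu : u ∈ Set.Icc 0 t) :
    @Measurable _ _ (borelSup t) _ fun y : ContPathIcc t => y.1 u := by
  borelize C(Set.Icc 0 t, ℝ)
  exact (continuous_eval_const (⟨u, hu⟩ : Set.Icc 0 t)).measurable.comp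
    (measurable_toContinuousMap (hu.1.trans hu.2))

end ContPathIcc

section PathLaw

variable {T : ℝ} {t : ℝ≥0} {s : ℕ → ℝ}

lemma sigmaBridgePath_apply (hB : IsStandardWiener P B) (ht : (t : ℝ) ∈ Set.Ioo 0 T) (α σv : ℝ) :
    ∀ᵐ ω ∂P, ∀ u, (sigmaBridgePath T α σv t B ω).1 u = σv * alphaWienerBridge T α B u ω := by
  filter_upwards [hB.cont] with ω hω u
  have hc : ContinuousOn (fun s => σv * alphaWienerBridge T α B s ω) (Set.Icc 0 t) :=
    continuousOn_const.mul (continuousOn_alphaWienerBridge ht α hω)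
  have : sigmaBridgePath T α σv t B ω = (⟨_, hc⟩ : ContPathIcc t) := dif_pos hc
  rw [this]

lemma measure_sigmaBridgePath_preimage (hB : IsStandardWiener P B) (ht : (t : ℝ) ∈ Set.Ioo 0 T)
    (hs : ∀ i, s i ∈ Set.Icc 0 (t : ℝ)) (α σv : ℝ) {S : Set (ℕ → ℝ)} (hS : MeasurableSet S) :
    P (sigmaBridgePath T α σv t B ⁻¹' ((fun y i => y.1 (s i)) ⁻¹' S)) =
      P.map (fun ω i => alphaWienerBridge T α B (s i) ω) ((fun z => σv • z) ⁻¹' S) := by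
  rw [Measure.map_apply_of_aemeasurable (aemeasurable_alphaWienerBridge hB ht hs α)
    (measurable_const_smul σv hS)]
  refine measure_congr ?_
  filter_upwards [sigmaBridgePath_apply hB ht α σv] with ω hω
  refine propext ?_
  change (fun i => (sigmaBridgePath T α σv t B ω).1 (s i)) ∈ S ↔ _
  simp only [hω]
  rfl

/-- The null sets of the law of the bridge do not depend on `α`. -/
lemma measure_sigmaBridgePath_eq_zero_iff [IsProbabilityMeasure P] (hB : IsStandardWiener P B)
    (ht : (t : ℝ) ∈ Set.Ioo 0 T) (α σv : ℝ) {S : Set (ContPathIcc t)}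
    (hS : MeasurableSet[borelSup t] S) :
    P (sigmaBridgePath T α σv t B ⁻¹' S) = 0 ↔ P (sigmaBridgePath T 0 σv t B ⁻¹' S) = 0 := by
  obtain ⟨s, hs, hd⟩ := exists_seq_Icc_subset_closure ht.1.le
  obtain ⟨S', hS', rfl⟩ := ContPathIcc.exists_measurableSet_preimage_eq ht.1.le hs hd hS
  obtain ⟨h1, h2⟩ := map_alphaWienerBridge_absolutelyContinuous hB ht hs α
  rw [measure_sigmaBridgePath_preimage hB ht hs α σv hS',
    measure_sigmaBridgePath_preimage hB ht hs 0 σv hS']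
  exact ⟨fun h => h2 h, fun h => h1 h⟩

end PathLaw

section QuadraticVariation

/-- Averages of the normalised squared increments over the dyadic scales of `[0, t]`. -/
def dyadicQuadVar (t : ℝ) (y : ℝ → ℝ) (n : ℕ) : ℝ :=
  (∑ k ∈ Finset.range n, ((y (t / 2 ^ k) - y (t / 2 ^ (k + 1))) / √(t / 2 ^ (k + 1))) ^ 2) / n

lemma measurableSet_tendsto_dyadicQuadVar {t : ℝ} (ht : 0 ≤ t) (c : ℝ) :
    MeasurableSet[borelSup t]
      {y : ContPathIcc t | Tendsto (dyadicQuadVar t y.1) atTop (𝓝 c)} := by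
  let _ : MeasurableSpace (ContPathIcc t) := borelSup t
  have hmem (k : ℕ) : t / 2 ^ k ∈ Set.Icc 0 t :=
    ⟨by positivity, div_le_self ht (one_le_pow₀ one_le_two)⟩
  refine measurableSet_tendsto (𝓝 c) fun n => ?_
  unfold dyadicQuadVar
  refine Measurable.div_const (Finset.measurable_sum _ fun k _ => ?_) _
  exact (((ContPathIcc.measurable_apply (hmem k)).sub
    (ContPathIcc.measurable_apply (hmem (k + 1)))).div_const _).pow_const 2

lemma dyadicQuadVar_const_mul (t c : ℝ) (y : ℝ → ℝ) (n : ℕ) :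
    dyadicQuadVar t (fun u => c * y u) n = c ^ 2 * dyadicQuadVar t y n := by
  simp only [dyadicQuadVar, ← mul_sub, mul_div_assoc, mul_pow, ← Finset.mul_sum]

/-- Normalised increments of `B` over the dyadic scales of `[0, t]`. -/
def dyadicIncr (B : ℝ → Ω → ℝ) (t : ℝ) (k : ℕ) (ω : Ω) : ℝ :=
  (B (t / 2 ^ k) ω - B (t / 2 ^ (k + 1)) ω) / √(t / 2 ^ (k + 1))

namespace IsStandardWiener

variable {t : ℝ}

lemma measurable_dyadicIncr (hB : IsStandardWiener P B) (t : ℝ) (k : ℕ) :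
    Measurable (dyadicIncr B t k) :=
  ((hB.meas _).sub (hB.meas _)).div_const _

lemma map_dyadicIncr (hB : IsStandardWiener P B) (ht : 0 < t) (k : ℕ) :
    P.map (dyadicIncr B t k) = gaussianReal 0 1 := by
  have hpos : 0 < t / 2 ^ (k + 1) := by positivity
  have hdiff : t / 2 ^ k - t / 2 ^ (k + 1) = t / 2 ^ (k + 1) := by
    rw [pow_succ]
    field_simp
    ring
  have hlaw := hB.incr_law (t / 2 ^ (k + 1)) (t / 2 ^ k) hpos.le (by linarith)
  rw [hdiff] at hlaw
  have hcomp : dyadicIncr B t k = (fun x => x / √(t / 2 ^ (k + 1))) ∘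
      fun ω => B (t / 2 ^ k) ω - B (t / 2 ^ (k + 1)) ω := rfl
  have hmeas : Measurable fun ω => B (t / 2 ^ k) ω - B (t / 2 ^ (k + 1)) ω :=
    (hB.meas _).sub (hB.meas _)
  rw [hcomp, ← Measure.map_map (by fun_prop) hmeas, hlaw,
    gaussianReal_map_div_const, zero_div]
  congr 1
  ext
  rw [NNReal.coe_div, Real.coe_toNNReal _ hpos.le, NNReal.coe_mk, Real.sq_sqrt hpos.le,
    div_self hpos.ne', NNReal.coe_one]

lemma indepFun_dyadicIncr (hB : IsStandardWiener P B) (ht : 0 < t) {i j : ℕ} (hij : i < j) :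
    IndepFun (dyadicIncr B t i) (dyadicIncr B t j) P := by
  have hmem {k : ℕ} (hk : i + 1 ≤ k) : t / 2 ^ k ∈ Set.Icc 0 (t / 2 ^ (i + 1)) :=
    ⟨by positivity, by gcongr; exact one_le_two⟩
  have hle : t / 2 ^ (i + 1) ≤ t / 2 ^ i := by
    gcongr
    · exact one_le_two
    · exact i.le_succ
  let φ (p : Set.Icc 0 (t / 2 ^ (i + 1)) → ℝ) : ℝ :=
    (p ⟨_, hmem hij⟩ - p ⟨_, hmem (hij.trans j.lt_succ_self)⟩) / √(t / 2 ^ (j + 1))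
  have hφ : Measurable φ := by fun_prop
  exact (hB.incr_indep _ _ (by positivity) hle).comp
    (φ := fun x => x / √(t / 2 ^ (i + 1))) (by fun_prop) hφ

lemma tendsto_dyadicQuadVar [IsProbabilityMeasure P] (hB : IsStandardWiener P B) (ht : 0 < t) :
    ∀ᵐ ω ∂P, Tendsto (dyadicQuadVar t fun u => B u ω) atTop (𝓝 1) := by
  have hm (k : ℕ) := hB.measurable_dyadicIncr t k
  have hsq : Measurable fun x : ℝ => x ^ 2 := by fun_prop
  have hident (i : ℕ) : IdentDistrib (fun ω => dyadicIncr B t i ω ^ 2)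
      (fun ω => dyadicIncr B t 0 ω ^ 2) P P :=
    IdentDistrib.comp ⟨(hm i).aemeasurable, (hm 0).aemeasurable, by
      rw [hB.map_dyadicIncr ht, hB.map_dyadicIncr ht]⟩ hsq
  have hindep : Pairwise fun i j =>
      IndepFun (fun ω => dyadicIncr B t i ω ^ 2) (fun ω => dyadicIncr B t j ω ^ 2) P := by
    intro i j hij
    rcases hij.lt_or_gt with h | h
    · exact (hB.indepFun_dyadicIncr ht h).comp hsq hsq
    · exact ((hB.indepFun_dyadicIncr ht h).comp hsq hsq).symm
  have hlp : MemLp (dyadicIncr B t 0) 2 P := by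
    have := memLp_id_gaussianReal (μ := 0) (v := 1) 2
    rw [← hB.map_dyadicIncr ht 0] at this
    exact this.comp_of_map (hm 0).aemeasurable
  have hmean : ∫ ω, dyadicIncr B t 0 ω ^ 2 ∂P = 1 := by
    have h1 : ∫ x, x ^ 2 ∂(P.map (dyadicIncr B t 0)) = ∫ ω, dyadicIncr B t 0 ω ^ 2 ∂P :=
      integral_map (hm 0).aemeasurable hsq.aestronglyMeasurable
    have h2 := variance_of_integral_eq_zero (X := id) (μ := gaussianReal 0 1)
      aemeasurable_id integral_id_gaussianReal
    rw [variance_id_gaussianReal] at h2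
    rw [← h1, hB.map_dyadicIncr ht]
    simpa using h2.symm
  have := strong_law_ae_real (fun i ω => dyadicIncr B t i ω ^ 2) hlp.integrable_sq hindep hident
  rwa [hmean] at this

end IsStandardWiener

end QuadraticVariation

lemma sigmaBridgePath_mem_ae [IsProbabilityMeasure P] (hB : IsStandardWiener P B) {T : ℝ} {t : ℝ≥0}
    (ht : (t : ℝ) ∈ Set.Ioo 0 T) (α σv : ℝ) :
    ∀ᵐ ω ∂P, sigmaBridgePath T α σv t B ω ∈
      {y : ContPathIcc t | Tendsto (dyadicQuadVar t y.1) atTop (𝓝 (σv ^ 2))} := by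
  have hS := measurableSet_tendsto_dyadicQuadVar t.coe_nonneg (σv ^ 2)
  refine (measure_sigmaBridgePath_eq_zero_iff hB ht α σv (@MeasurableSet.compl _ _ _ hS)).2 ?_
  change ∀ᵐ ω ∂P, _
  filter_upwards [sigmaBridgePath_apply hB ht 0 σv, hB.tendsto_dyadicQuadVar ht.1] with ω hω hlim
  have : (sigmaBridgePath T 0 σv t B ω).1 = fun u => σv * B u ω := by
    ext u
    simp [hω, alphaWienerBridge]
  rw [this]
  simpa [funext (dyadicQuadVar_const_mul (t : ℝ) σv fun u => B u ω)] using hlim.const_mul (σv ^ 2)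

/-- Dichotomy for the laws of `X^{(α₁,σ₁)}` and `X^{(α₂,σ₂)}` on
`(C[0,t], ℬ(C[0,t]))`, `t ∈ (0,T)`: they are equivalent if `σ₁ = σ₂`, and mutually singular
if `σ₁ ≠ σ₂`. -/
theorem sigmaBridge_laws_dichotomy
    (P : Measure Ω) [IsProbabilityMeasure P]
    (T : ℝ) (hT : 0 < T) (B : ℝ → Ω → ℝ) (hB : IsStandardWiener P B)
    (α₁ α₂ σ₁ σ₂ : ℝ) (hσ₁ : 0 < σ₁) (hσ₂ : 0 < σ₂)
    (t : ℝ) (ht : t ∈ Set.Ioo (0:ℝ) T) :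
    (σ₁ = σ₂ → ∀ S : Set (ContPathIcc t), MeasurableSet[borelSup t] S →
      (P (sigmaBridgePath T α₁ σ₁ t B ⁻¹' S) = 0 ↔
        P (sigmaBridgePath T α₂ σ₂ t B ⁻¹' S) = 0)) ∧
    (σ₁ ≠ σ₂ → ∃ S₁ S₂ : Set (ContPathIcc t),
      MeasurableSet[borelSup t] S₁ ∧ MeasurableSet[borelSup t] S₂ ∧ S₁ ∩ S₂ = ∅ ∧
      P (sigmaBridgePath T α₁ σ₁ t B ⁻¹' S₁) = 1 ∧
      P (sigmaBridgePath T α₂ σ₂ t B ⁻¹' S₂) = 1) := by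
  lift t to ℝ≥0 using ht.1.le
  refine ⟨?_, fun hσ => ?_⟩
  · rintro rfl S hS
    exact (measure_sigmaBridgePath_eq_zero_iff hB ht α₁ σ₁ hS).trans
      (measure_sigmaBridgePath_eq_zero_iff hB ht α₂ σ₁ hS).symm
  · refine ⟨_, _, measurableSet_tendsto_dyadicQuadVar t.coe_nonneg (σ₁ ^ 2),
      measurableSet_tendsto_dyadicQuadVar t.coe_nonneg (σ₂ ^ 2), ?_, ?_, ?_⟩
    · refine eq_empty_of_forall_notMem fun y hy => hσ ?_
      exact (sq_eq_sq₀ hσ₁.le hσ₂.le).1 (tendsto_nhds_unique hy.1 hy.2)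
    · exact (measure_congr (eventuallyEq_univ.2 (sigmaBridgePath_mem_ae hB ht α₁ σ₁))).trans
        measure_univ
    · exact (measure_congr (eventuallyEq_univ.2 (sigmaBridgePath_mem_ae hB ht α₂ σ₂))).trans
        measure_univ
end
end

section
/- For α ∈ ℝ and σ > 0 let X^{(α,σ)}_t := σ ∫₀ᵗ ((T−t)/(T−s))^α dB_s, t ∈ [0,T). Then for every t ∈ (0,T) the quadratic variation along uniform partitions converges almost surely: P( lim_{n→∞} Σ_{j=1}^n ( X^{(α,σ)}_{jt/n} − X^{(α,σ)}_{(j−1)t/n} )² = tσ² ) = 1. -/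
open MeasureTheory ProbabilityTheory Filter Set Topology
open scoped ENNReal NNReal

noncomputable section

variable {Ω : Type*} [MeasurableSpace Ω]

theorem exists_lipschitzOnWith_drift {T t : ℝ} (ht : t ∈ Set.Ioo (0 : ℝ) T) (α : ℝ) {b : ℝ → ℝ}
    (hb : Continuous b) :
    ∃ K, LipschitzOnWith K (fun s => α * (T - s) ^ α *
      ∫ u in Set.Ioc (0 : ℝ) s, (T - u) ^ (-α - 1) * b u) (Set.Icc 0 t) := by
  set g : ℝ → ℝ := fun u => (T - min u t) ^ (-α - 1) * b u with hg
  have hpos : ∀ u, T - min u t ≠ 0 := fun u => by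
    have := min_le_right u t
    have := ht.2
    linarith
  have hgc : Continuous g := by
    refine Continuous.mul (Continuous.rpow_const (by fun_prop) fun u => Or.inl (hpos u)) hb
  have hG : ContDiff ℝ 1 fun s => ∫ u in (0 : ℝ)..s, g u := by
    refine contDiff_one_iff_deriv.2 ⟨fun s =>
      (hgc.integral_hasStrictDerivAt 0 s).hasDerivAt.differentiableAt, ?_⟩
    rw [funext (Continuous.deriv_integral g hgc 0)]
    exact hgc
  have hF : ContDiffOn ℝ 1 (fun s => α * (T - s) ^ α * ∫ u in (0 : ℝ)..s, g u) (Set.Icc 0 t) := by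
    refine ContDiffOn.mul (contDiffOn_const.mul
      (ContDiffOn.rpow_const_of_ne (by fun_prop) fun s hs => ?_)) hG.contDiffOn
    have := hs.2
    have := ht.2
    linarith
  obtain ⟨K, hK⟩ := hF.exists_lipschitzOnWith one_ne_zero (convex_Icc 0 t) isCompact_Icc
  have heq : Set.EqOn (fun s => α * (T - s) ^ α * ∫ u in Set.Ioc (0 : ℝ) s,
      (T - u) ^ (-α - 1) * b u) (fun s => α * (T - s) ^ α * ∫ u in (0 : ℝ)..s, g u)
      (Set.Icc 0 t) := fun s hs => by
    simp only
    rw [intervalIntegral.integral_of_le hs.1]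
    congr 1
    refine setIntegral_congr_fun measurableSet_Ioc fun u hu => ?_
    simp only [hg, min_eq_left (hu.2.trans hs.2)]
  exact ⟨K, fun x hx y hy => by rw [heq hx, heq hy]; exact hK hx hy⟩

theorem tendsto_sum_sq_increments_sub_lipschitz {t q : ℝ} (ht : 0 ≤ t) {b a : ℝ → ℝ} {K : ℝ≥0}
    (ha : LipschitzOnWith K a (Set.Icc 0 t))
    (hb : Tendsto (fun n : ℕ => ∑ j ∈ Finset.range n,
      (b ((j + 1) * t / n) - b (j * t / n)) ^ 2) atTop (𝓝 q)) :
    Tendsto (fun n : ℕ => ∑ j ∈ Finset.range n,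
      ((b ((j + 1) * t / n) - a ((j + 1) * t / n)) - (b (j * t / n) - a (j * t / n))) ^ 2)
      atTop (𝓝 q) := by
  have ha0 : Tendsto (fun n : ℕ => ∑ j ∈ Finset.range n,
      (a ((j + 1) * t / n) - a (j * t / n)) ^ 2) atTop (𝓝 0) := by
    have hlim : Tendsto (fun n : ℕ => (K * t : ℝ) ^ 2 / n) atTop (𝓝 0) :=
      tendsto_const_div_atTop_nhds_zero_nat _
    refine squeeze_zero (fun n => Finset.sum_nonneg fun j _ => sq_nonneg _) (fun n => ?_) hlim
    have hle : ∀ j ∈ Finset.range n,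
        (a ((j + 1) * t / n) - a (j * t / n)) ^ 2 ≤ (K * t / n : ℝ) ^ 2 := by
      intro j hj
      have hjn : (j : ℝ) + 1 ≤ n := by exact_mod_cast Finset.mem_range.1 hj
      have hj0 : (0 : ℝ) ≤ j := j.cast_nonneg
      have hn : (0 : ℝ) < n := by linarith
      have h1 : ((j : ℝ) + 1) * t / n ∈ Set.Icc 0 t :=
        ⟨by positivity, by rw [div_le_iff₀ hn]; nlinarith⟩
      have h2 : (j : ℝ) * t / n ∈ Set.Icc 0 t :=
        ⟨by positivity, by rw [div_le_iff₀ hn]; nlinarith⟩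
      have h := ha.dist_le_mul _ h1 _ h2
      rw [Real.dist_eq, Real.dist_eq,
        show ((j : ℝ) + 1) * t / n - j * t / n = t / n by ring,
        abs_of_nonneg (div_nonneg ht hn.le), ← mul_div_assoc] at h
      exact sq_le_sq.2 (h.trans (le_abs_self _))
    refine (Finset.sum_le_sum hle).trans ?_
    rcases eq_or_ne n 0 with rfl | hn
    · simp
    · simp only [Finset.sum_const, Finset.card_range, nsmul_eq_mul]
      exact le_of_eq (by field_simp)
  have hcross : Tendsto (fun n : ℕ => ∑ j ∈ Finset.range n,
      (b ((j + 1) * t / n) - b (j * t / n)) * (a ((j + 1) * t / n) - a (j * t / n)))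
      atTop (𝓝 0) := by
    have hs : Tendsto (fun n : ℕ => (∑ j ∈ Finset.range n,
        (b ((j + 1) * t / n) - b (j * t / n)) * (a ((j + 1) * t / n) - a (j * t / n))) ^ 2)
        atTop (𝓝 0) :=
      squeeze_zero (fun n => sq_nonneg _)
        (fun n => Finset.sum_mul_sq_le_sq_mul_sq _ _ _) (by simpa using hb.mul ha0)
    have := hs.sqrt
    simp only [Real.sqrt_sq_eq_abs, Real.sqrt_zero] at this
    exact (tendsto_zero_iff_abs_tendsto_zero _).2 this
  have h := (hb.sub (hcross.const_mul 2)).add ha0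
  simp only [mul_zero, sub_zero, add_zero] at h
  refine h.congr fun n => ?_
  rw [Finset.mul_sum, ← Finset.sum_sub_distrib, ← Finset.sum_add_distrib]
  exact Finset.sum_congr rfl fun j _ => by ring

theorem integrable_pow_of_memLp {P : Measure Ω} [IsFiniteMeasure P] {X : Ω → ℝ} {n k : ℕ}
    (hX : MemLp X n P) (hk : k ≤ n) : Integrable (fun ω => X ω ^ k) P := by
  have h : MemLp X k P := hX.mono_exponent (by exact_mod_cast hk)
  refine (integrable_norm_iff (hX.aestronglyMeasurable.pow k)).1 ?_
  simpa only [Pi.pow_apply, norm_pow] using h.integrable_norm_pow'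

theorem integral_pow_mul_pow_of_indepFun {P : Measure Ω} [IsProbabilityMeasure P] {X Y : Ω → ℝ}
    (h : IndepFun X Y P) (hX : AEStronglyMeasurable X P) (hY : AEStronglyMeasurable Y P)
    (j k : ℕ) :
    ∫ ω, X ω ^ j * Y ω ^ k ∂P = (∫ ω, X ω ^ j ∂P) * ∫ ω, Y ω ^ k ∂P :=
  IndepFun.integral_fun_mul_eq_mul_integral
    (h.comp (φ := fun x => x ^ j) (ψ := fun x => x ^ k) (by fun_prop) (by fun_prop))
    (hX.pow j) (hY.pow k)

theorem integrable_pow_mul_pow_of_indepFun {P : Measure Ω} [IsProbabilityMeasure P]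
    {X Y : Ω → ℝ} {n : ℕ} (h : IndepFun X Y P) (hX : MemLp X n P) (hY : MemLp Y n P)
    {j k : ℕ} (hj : j ≤ n) (hk : k ≤ n) : Integrable (fun ω => X ω ^ j * Y ω ^ k) P :=
  IndepFun.integrable_mul
    (h.comp (φ := fun x => x ^ j) (ψ := fun x => x ^ k) (by fun_prop) (by fun_prop))
    (integrable_pow_of_memLp hX hj) (integrable_pow_of_memLp hY hk)

theorem moments_sum_le_of_indepFun_partial_sums {P : Measure Ω} [IsProbabilityMeasure P]
    {Y : ℕ → Ω → ℝ} {N : ℕ} {a b : ℝ}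
    (hY : ∀ k < N, MemLp (Y k) (4 : ℕ) P) (hmean : ∀ k < N, ∫ ω, Y k ω ∂P = 0)
    (hvar : ∀ k < N, ∫ ω, Y k ω ^ 2 ∂P ≤ a) (hfour : ∀ k < N, ∫ ω, Y k ω ^ 4 ∂P ≤ b)
    (hind : ∀ k < N, IndepFun (fun ω => ∑ j ∈ Finset.range k, Y j ω) (Y k) P)
    {k : ℕ} (hk : k ≤ N) :
    ∫ ω, ∑ j ∈ Finset.range k, Y j ω ∂P = 0 ∧
    ∫ ω, (∑ j ∈ Finset.range k, Y j ω) ^ 2 ∂P ≤ k * a ∧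
    ∫ ω, (∑ j ∈ Finset.range k, Y j ω) ^ 4 ∂P ≤ k * b + 3 * k ^ 2 * a ^ 2 := by
  induction k with
  | zero => simp
  | succ k ih =>
    obtain ⟨ih1, ih2, ih4⟩ := ih (by omega)
    have hkN : k < N := hk
    set S : Ω → ℝ := fun ω => ∑ j ∈ Finset.range k, Y j ω
    have hS : MemLp S (4 : ℕ) P :=
      memLp_finsetSum _ fun j hj => hY j ((Finset.mem_range.1 hj).trans hkN)
    have hYk := hY k hkN
    have hSY := hind k hkN
    have e : ∀ i l : ℕ, ∫ ω, S ω ^ i * Y k ω ^ l ∂P = (∫ ω, S ω ^ i ∂P) * ∫ ω, Y k ω ^ l ∂P :=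
      integral_pow_mul_pow_of_indepFun hSY hS.1 hYk.1
    have I : ∀ i l : ℕ, i ≤ 4 → l ≤ 4 → Integrable (fun ω => S ω ^ i * Y k ω ^ l) P :=
      fun i l hi hl => integrable_pow_mul_pow_of_indepFun hSY hS hYk hi hl
    have hYm := hmean k hkN
    have hv := hvar k hkN
    have hf := hfour k hkN
    have hv0 : 0 ≤ ∫ ω, Y k ω ^ 2 ∂P := integral_nonneg fun ω => sq_nonneg _
    have hs0 : 0 ≤ ∫ ω, S ω ^ 2 ∂P := integral_nonneg fun ω => sq_nonneg _
    simp only [Finset.sum_range_succ]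
    have e1 : ∫ ω, S ω + Y k ω ∂P = 0 := by
      rw [integral_add (by simpa using I 1 0 (by norm_num) (by norm_num))
        (by simpa using I 0 1 (by norm_num) (by norm_num)), ih1, hYm, add_zero]
    have e2 : ∫ ω, (S ω + Y k ω) ^ 2 ∂P = ∫ ω, S ω ^ 2 ∂P + ∫ ω, Y k ω ^ 2 ∂P := by
      have : ∀ ω, (S ω + Y k ω) ^ 2 =
          S ω ^ 2 * Y k ω ^ 0 + 2 * (S ω ^ 1 * Y k ω ^ 1) + S ω ^ 0 * Y k ω ^ 2 :=
        fun ω => by ring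
      simp only [this]
      rw [integral_add ((I 2 0 (by norm_num) (by norm_num)).fun_add
          ((I 1 1 (by norm_num) (by norm_num)).const_mul 2)) (I 0 2 (by norm_num) (by norm_num)),
        integral_add (I 2 0 (by norm_num) (by norm_num))
          ((I 1 1 (by norm_num) (by norm_num)).const_mul 2), integral_const_mul, e, e, e]
      simp [hYm]
    have e4 : ∫ ω, (S ω + Y k ω) ^ 4 ∂P = ∫ ω, S ω ^ 4 ∂P +
        6 * ((∫ ω, S ω ^ 2 ∂P) * ∫ ω, Y k ω ^ 2 ∂P) + ∫ ω, Y k ω ^ 4 ∂P := by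
      have : ∀ ω, (S ω + Y k ω) ^ 4 =
          S ω ^ 4 * Y k ω ^ 0 + 4 * (S ω ^ 3 * Y k ω ^ 1) + 6 * (S ω ^ 2 * Y k ω ^ 2) +
            4 * (S ω ^ 1 * Y k ω ^ 3) + S ω ^ 0 * Y k ω ^ 4 :=
        fun ω => by ring
      simp only [this]
      have J0 := I 4 0 (by norm_num) (by norm_num)
      have J1 := (I 3 1 (by norm_num) (by norm_num)).const_mul 4
      have J2 := (I 2 2 (by norm_num) (by norm_num)).const_mul 6
      have J3 := (I 1 3 (by norm_num) (by norm_num)).const_mul 4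
      have J4 := I 0 4 (by norm_num) (by norm_num)
      rw [integral_add (((J0.fun_add J1).fun_add J2).fun_add J3) J4,
        integral_add ((J0.fun_add J1).fun_add J2) J3, integral_add (J0.fun_add J1) J2, integral_add J0 J1, integral_const_mul, integral_const_mul,
        integral_const_mul, e, e, e, e, e]
      simp [hYm, ih1]
    refine ⟨e1, ?_, ?_⟩
    · rw [e2]
      push_cast
      linarith
    · rw [e4]
      have : (∫ ω, S ω ^ 2 ∂P) * ∫ ω, Y k ω ^ 2 ∂P ≤ k * a * a :=
        mul_le_mul ih2 hv hv0 (hs0.trans ih2)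
      push_cast
      nlinarith [sq_nonneg a]

theorem memLp_sq_sub_const_gaussianReal (v : ℝ≥0) (c : ℝ) (n : ℕ) :
    MemLp (fun x : ℝ => x ^ 2 - c) n (gaussianReal 0 v) := by
  have hp : (2 * n : ℝ≥0∞) ≠ ∞ := ENNReal.mul_ne_top (by simp) (by simp)
  have : ENNReal.HolderTriple (2 * n) (2 * n) n :=
    ⟨by rw [ENNReal.mul_inv (by simp) (by simp), ← add_mul, ENNReal.inv_two_add_inv_two, one_mul]⟩
  have hid := memLp_id_gaussianReal' (μ := 0) (v := v) _ hp
  simpa only [sq, id] using! (hid.mul' hid (r := n)).sub (memLp_const c)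

theorem integral_sq_sub_variance_pow_gaussianReal (v : ℝ≥0) (n : ℕ) :
    ∫ x, (x ^ 2 - v : ℝ) ^ n ∂gaussianReal 0 v =
      v ^ n * ∫ x, (x ^ 2 - 1 : ℝ) ^ n ∂gaussianReal 0 1 := by
  have h : gaussianReal 0 v = (gaussianReal 0 1).map (√(v : ℝ) * ·) := by
    rw [gaussianReal_map_const_mul]
    congr 1
    · simp
    · ext; simp
  rw [h, integral_map (by fun_prop) (by fun_prop), ← integral_const_mul]
  refine integral_congr_ae (.of_forall fun x => ?_)
  simp only [mul_pow, Real.sq_sqrt v.coe_nonneg]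
  rw [← mul_pow, mul_sub, mul_one]

theorem integral_sq_sub_variance_gaussianReal (v : ℝ≥0) :
    ∫ x, (x ^ 2 - v : ℝ) ∂gaussianReal 0 v = 0 := by
  have h := variance_id_gaussianReal (μ := 0) (v := v)
  rw [variance_eq_sub (memLp_id_gaussianReal' 2 (by simp))] at h
  have hi : Integrable (fun x : ℝ => x ^ 2) (gaussianReal 0 v) :=
    integrable_pow_of_memLp (n := 2) (memLp_id_gaussianReal' _ (by simp)) le_rfl
  rw [integral_sub hi (integrable_const _)]
  simp at h ⊢
  linarith

theorem ae_tendsto_zero_of_summable_integral {P : Measure Ω} {f : ℕ → Ω → ℝ}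
    (hf : ∀ n, Integrable (f n) P) (hf0 : ∀ n ω, 0 ≤ f n ω)
    (hs : Summable fun n => ∫ ω, f n ω ∂P) :
    ∀ᵐ ω ∂P, Tendsto (fun n => f n ω) atTop (𝓝 0) := by
  have hm : ∀ n, AEMeasurable (fun ω => ENNReal.ofReal (f n ω)) P := fun n =>
    (hf n).aemeasurable.ennreal_ofReal
  have hfin : ∫⁻ ω, ∑' n, ENNReal.ofReal (f n ω) ∂P ≠ ∞ := by
    rw [lintegral_tsum hm]
    have h : ∀ n, ∫⁻ ω, ENNReal.ofReal (f n ω) ∂P = ENNReal.ofReal (∫ ω, f n ω ∂P) := fun n =>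
      (ofReal_integral_eq_lintegral_ofReal (hf n) (.of_forall (hf0 n))).symm
    simp only [h]
    exact hs.tsum_ofReal_ne_top
  filter_upwards [ae_lt_top' (AEMeasurable.tsum hm) hfin] with ω hω
  have h := (ENNReal.tendsto_toReal_zero_iff (fun n => ENNReal.ofReal_ne_top)).2
    (ENNReal.tendsto_atTop_zero_of_tsum_ne_top hω.ne)
  simpa only [ENNReal.toReal_ofReal (hf0 _ ω)] using h

namespace IsStandardWiener

variable {P : Measure Ω} {B : ℝ → Ω → ℝ}

theorem indepFun_sum_sq_increments (hB : IsStandardWiener P B) {τ : ℕ → ℝ} (h0 : 0 ≤ τ 0)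
    (hτ : Monotone τ) (c : ℝ) (k : ℕ) :
    IndepFun (fun ω => ∑ j ∈ Finset.range k, ((B (τ (j + 1)) ω - B (τ j) ω) ^ 2 - c))
      (fun ω => (B (τ (k + 1)) ω - B (τ k) ω) ^ 2 - c) P := by
  have hk0 : 0 ≤ τ k := h0.trans (hτ k.zero_le)
  have hi := (hB.incr_indep (τ k) (τ (k + 1)) hk0 (hτ k.le_succ)).symm
  have h := hi.comp
    (φ := fun p => ∑ j ∈ Finset.range k,
      ((p (Set.projIcc 0 (τ k) hk0 (τ (j + 1))) - p (Set.projIcc 0 (τ k) hk0 (τ j))) ^ 2 - c))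
    (ψ := fun x => x ^ 2 - c) (by fun_prop) (by fun_prop)
  refine h.congr (.of_forall fun ω => ?_) (.of_forall fun ω => rfl)
  refine Finset.sum_congr rfl fun j hj => ?_
  have hjk := Finset.mem_range.1 hj
  rw [Set.projIcc_of_mem hk0 ⟨h0.trans (hτ (Nat.zero_le _)), hτ hjk⟩,
    Set.projIcc_of_mem hk0 ⟨h0.trans (hτ (Nat.zero_le _)), hτ hjk.le⟩]

theorem fourth_moment_sum_sq_increments_le [IsProbabilityMeasure P] (hB : IsStandardWiener P B)
    {t : ℝ} (ht : 0 ≤ t) {n : ℕ} (hn : n ≠ 0) :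
    Integrable (fun ω => (∑ j ∈ Finset.range n,
      (B ((j + 1) * t / n) ω - B (j * t / n) ω) ^ 2 - t) ^ 4) P ∧
    ∫ ω, (∑ j ∈ Finset.range n, (B ((j + 1) * t / n) ω - B (j * t / n) ω) ^ 2 - t) ^ 4 ∂P ≤
      t ^ 4 * (∫ x, (x ^ 2 - 1) ^ 4 ∂gaussianReal 0 1 +
        3 * (∫ x, (x ^ 2 - 1) ^ 2 ∂gaussianReal 0 1) ^ 2) * (1 / (n : ℝ) ^ 2) := by
  set τ : ℕ → ℝ := fun j => j * t / n with hτdef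
  have hτ : Monotone τ := fun i j hij => by
    simp only [hτdef]
    gcongr
  have h0 : τ 0 = 0 := by simp [hτdef]
  have hτn : ∀ j : ℕ, 0 ≤ τ j := fun j => h0 ▸ hτ j.zero_le
  set v : ℝ≥0 := (t / n).toNNReal with hv
  have hvt : (v : ℝ) = t / n := Real.coe_toNNReal _ (by positivity)
  set Y : ℕ → Ω → ℝ := fun j ω => (B (τ (j + 1)) ω - B (τ j) ω) ^ 2 - v with hYdef
  have hlaw : ∀ j, MeasurePreserving (fun ω => B (τ (j + 1)) ω - B (τ j) ω) P
      (gaussianReal 0 v) := fun j => by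
    refine ⟨(hB.meas _).sub (hB.meas _), ?_⟩
    rw [hB.incr_law _ _ (hτn j) (hτ j.le_succ), hv]
    congr 2
    simp only [hτdef]
    push_cast
    ring
  have hint : ∀ (j : ℕ) (f : ℝ → ℝ), Measurable f →
      ∫ ω, f (B (τ (j + 1)) ω - B (τ j) ω) ∂P = ∫ x, f x ∂gaussianReal 0 v := fun j f hf => by
    rw [← (hlaw j).map_eq, integral_map (hlaw j).aemeasurable hf.aestronglyMeasurable]
  have hYp : ∀ j, MemLp (Y j) (4 : ℕ) P := fun j =>
    (memLp_sq_sub_const_gaussianReal v v 4).comp_measurePreserving (hlaw j)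
  have hmean : ∀ j, ∫ ω, Y j ω ∂P = 0 := fun j =>
    (hint j (fun x => x ^ 2 - v) (by fun_prop)).trans (integral_sq_sub_variance_gaussianReal v)
  have hpow : ∀ j m : ℕ, ∫ ω, Y j ω ^ m ∂P =
      v ^ m * ∫ x, (x ^ 2 - 1 : ℝ) ^ m ∂gaussianReal 0 1 := fun j m =>
    (hint j (fun x => (x ^ 2 - v) ^ m) (by fun_prop)).trans
      (integral_sq_sub_variance_pow_gaussianReal v m)
  have hsum : ∀ ω, ∑ j ∈ Finset.range n, (B ((j + 1) * t / n) ω - B (j * t / n) ω) ^ 2 - t =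
      ∑ j ∈ Finset.range n, Y j ω := fun ω => by
    simp only [hYdef, hτdef, Finset.sum_sub_distrib, Finset.sum_const, Finset.card_range,
      nsmul_eq_mul, hvt, Nat.cast_add, Nat.cast_one]
    congr 1
    field_simp
  simp only [hsum]
  have hS : MemLp (fun ω => ∑ j ∈ Finset.range n, Y j ω) (4 : ℕ) P :=
    memLp_finsetSum _ fun j _ => hYp j
  refine ⟨integrable_pow_of_memLp hS le_rfl, ?_⟩
  refine (moments_sum_le_of_indepFun_partial_sums (fun j _ => hYp j) (fun j _ => hmean j)
    (fun j _ => (hpow j 2).le) (fun j _ => (hpow j 4).le)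
    (fun j _ => hB.indepFun_sum_sq_increments h0.ge hτ v j) le_rfl).2.2.trans ?_
  have hc : 0 ≤ ∫ x, (x ^ 2 - 1 : ℝ) ^ 4 ∂gaussianReal 0 1 :=
    integral_nonneg fun x => by positivity
  set c₄ := ∫ x, (x ^ 2 - 1 : ℝ) ^ 4 ∂gaussianReal 0 1
  set c₂ := ∫ x, (x ^ 2 - 1 : ℝ) ^ 2 ∂gaussianReal 0 1
  have hn1 : (1 : ℝ) ≤ n := by exact_mod_cast Nat.one_le_iff_ne_zero.2 hn
  have hle : (n : ℝ) * ((t / n) ^ 4 * c₄) ≤ n ^ 2 * ((t / n) ^ 4 * c₄) := by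
    gcongr
    nlinarith
  rw [hvt]
  calc (n : ℝ) * ((t / n) ^ 4 * c₄) + 3 * n ^ 2 * ((t / n) ^ 2 * c₂) ^ 2
      ≤ n ^ 2 * ((t / n) ^ 4 * c₄) + 3 * n ^ 2 * ((t / n) ^ 2 * c₂) ^ 2 := by gcongr
    _ = t ^ 4 * (c₄ + 3 * c₂ ^ 2) * (1 / (n : ℝ) ^ 2) := by
      field_simp

theorem ae_tendsto_sum_sq_increments [IsProbabilityMeasure P] (hB : IsStandardWiener P B)
    {t : ℝ} (ht : 0 ≤ t) :
    ∀ᵐ ω ∂P, Tendsto (fun n : ℕ => ∑ j ∈ Finset.range n,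
      (B ((j + 1) * t / n) ω - B (j * t / n) ω) ^ 2) atTop (𝓝 t) := by
  set Z : ℕ → Ω → ℝ := fun n ω => (∑ j ∈ Finset.range n,
    (B ((j + 1) * t / n) ω - B (j * t / n) ω) ^ 2 - t) ^ 4 with hZdef
  have hZ0 : ∀ n ω, 0 ≤ Z n ω := fun n ω => Even.pow_nonneg (by decide) _
  have hZ := fun n : ℕ => hB.fourth_moment_sum_sq_increments_le ht n.succ_ne_zero
  have hsummable := (((summable_nat_add_iff 1).2
    (Real.summable_one_div_nat_pow.2 one_lt_two)).mul_left
      (t ^ 4 * (∫ x, (x ^ 2 - 1) ^ 4 ∂gaussianReal 0 1 +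
        3 * (∫ x, (x ^ 2 - 1) ^ 2 ∂gaussianReal 0 1) ^ 2))).of_nonneg_of_le
    (fun n => integral_nonneg (hZ0 (n + 1))) (fun n => (hZ n).2)
  filter_upwards [ae_tendsto_zero_of_summable_integral (fun n => (hZ n).1)
    (fun n => hZ0 (n + 1)) hsummable] with ω hω
  have hω' : Tendsto (fun n => Z n ω) atTop (𝓝 0) := (tendsto_add_atTop_iff_nat 1).1 hω
  have hroot := hω'.sqrt.sqrt
  simp only [Real.sqrt_zero] at hroot
  rw [← tendsto_sub_nhds_zero_iff, tendsto_zero_iff_abs_tendsto_zero]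
  refine hroot.congr fun n => ?_
  simp only [hZdef, Function.comp_apply]
  rw [show ∀ x : ℝ, x ^ 4 = (x ^ 2) ^ 2 from fun x => by ring, Real.sqrt_sq (sq_nonneg _),
    Real.sqrt_sq_eq_abs]

end IsStandardWiener

/-- For the process `X^{(α,σ)} = σ ∫₀^· ((T−·)/(T−s))^α dB_s` and every
`t ∈ (0,T)`, the quadratic variation along uniform partitions converges almost surely:
`P( lim_{n→∞} Σ_{j=1}^n (X^{(α,σ)}_{jt/n} − X^{(α,σ)}_{(j−1)t/n})² = tσ² ) = 1`. -/
theorem sigmaBridge_quadratic_variation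
    (P : Measure Ω) [IsProbabilityMeasure P]
    (T : ℝ) (hT : 0 < T) (B : ℝ → Ω → ℝ) (hB : IsStandardWiener P B)
    (α σv : ℝ) (hσ : 0 < σv) (t : ℝ) (ht : t ∈ Set.Ioo (0:ℝ) T) :
    ∀ᵐ ω ∂P, Tendsto (fun n : ℕ => ∑ j ∈ Finset.range n,
        (σv * alphaWienerBridge T α B ((j + 1) * t / n) ω -
          σv * alphaWienerBridge T α B (j * t / n) ω) ^ 2)
      atTop (𝓝 (t * σv ^ 2)) := by
  filter_upwards [hB.cont, hB.ae_tendsto_sum_sq_increments ht.1.le] with ω hc hqv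
  obtain ⟨K, hK⟩ := exists_lipschitzOnWith_drift ht α hc
  have h := (tendsto_sum_sq_increments_sub_lipschitz (b := (B · ω))
    ht.1.le hK hqv).mul_const (σv ^ 2)
  have heq : ∀ x y : ℝ, (σv * x - σv * y) ^ 2 = (x - y) ^ 2 * σv ^ 2 := fun x y => by ring
  simp only [heq, ← Finset.sum_mul, alphaWienerBridge]
  exact h
end
end
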